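/- arXiv:2206.09402 — 3 statements merged into one kernel-verified Lean document; each statement's English description precedes it below -/
import Mathlib

section
/- Suppose Condition (C) holds and a + b = 1. Then for any ε > 0 there exist N > 0 and k₀ > 0 such that for all integers m, k with k − N > m > k₀, P(m ∈ C^S and k ∈ C^S) ≤ (1+ε) · P(m ∈ C^S) · P(k ∈ C^S) · F_Y(2m+1)/F_Y(2m+1, 2k), where C^S = {k ≥ 1 : the layer L_k = {2k, 2k+1} contains a cutpoint of Y}. -/
open Filter MeasureTheory ENNReal Topology

noncomputable section

/-- Transition function of the (1,2) random walk `Y`. -/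
def transY (q p1 p2 : ℕ → ℝ) (n j : ℕ) : ℝ :=
  if n = 0 then (if j = 2 then 1 else 0)
  else if n = 1 then (if j = 0 then 1 else 0)
  else if j = n - 1 then q n
  else if j = n + 1 then p1 n
  else if j = n + 2 then p2 n
  else 0

/-- `μ` is the law (on path space) of the time-homogeneous Markov chain on `ℕ`
with one-step transition probabilities `p` and initial state `init`. -/
def IsMarkovChain (μ : Measure (ℕ → ℕ)) (p : ℕ → ℕ → ℝ) (init : ℕ) : Prop :=
  μ {ω | ω 0 = init} = 1 ∧
  ∀ (k : ℕ) (x : ℕ → ℕ) (j : ℕ),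
    μ {ω | (∀ i ≤ k, ω i = x i) ∧ ω (k + 1) = j}
      = ENNReal.ofReal (p (x k) j) * μ {ω | ∀ i ≤ k, ω i = x i}

/-- The matrix `A_k` with first row `(a_k, b_k)` and second row `(1, 0)`. -/
def Amat (q p1 p2 : ℕ → ℝ) (k : ℕ) : Matrix (Fin 2) (Fin 2) ℝ :=
  !![(p1 k + p2 k) / q k, p2 k / q k; 1, 0]

/-- The ordered product `A_s A_{s+1} ⋯ A_{n-1}` (identity when `s ≥ n`). -/
def prodAsc (q p1 p2 : ℕ → ℝ) (s n : ℕ) : Matrix (Fin 2) (Fin 2) ℝ :=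
  ((List.range (n - s)).map fun i => Amat q p1 p2 (s + i)).prod

/-- `ζ_{k,n} = (e₁ A_{k+1}⋯A_n e₁ᵗ)/(e₁ A_k⋯A_n e₁ᵗ)`. -/
def zetaApprox (q p1 p2 : ℕ → ℝ) (k n : ℕ) : ℝ :=
  prodAsc q p1 p2 (k + 1) (n + 1) 0 0 / prodAsc q p1 p2 k (n + 1) 0 0

/-- `F_Y(m,n) = 1 + Σ_{j=m+1}^{n-1} Π_{i=m+1}^{j} ζ_i`. -/
def FYfin (ζ : ℕ → ℝ) (m n : ℕ) : ℝ :=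
  1 + ∑ j ∈ Finset.Icc (m + 1) (n - 1), ∏ i ∈ Finset.Icc (m + 1) j, ζ i

/-- `F_Y(m) = lim_{n→∞} F_Y(m,n) ∈ (0,∞]` (the limit of the nondecreasing
sequence `F_Y(m,n)`, realized as a supremum in `ℝ≥0∞`). -/
def FYinf (ζ : ℕ → ℝ) (m : ℕ) : ℝ≥0∞ :=
  ⨆ n : ℕ, ENNReal.ofReal (FYfin ζ m n)

/-- One-step operator. -/
def stepE (p : ℕ → ℕ → ℝ) (Φ : ℕ → ℝ≥0∞) (x : ℕ) : ℝ≥0∞ :=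
  ∑' j, ENNReal.ofReal (p x j) * Φ j

/-- Restriction of a path to times `≤ t`. -/
def pathRestr (t : ℕ) (ω : ℕ → ℕ) : Fin (t + 1) → ℕ := fun i => ω i

lemma measurable_pathRestr (t : ℕ) : Measurable (pathRestr t) :=
  measurable_pi_lambda _ fun _ => measurable_pi_apply _

lemma markov_step {μ : Measure (ℕ → ℕ)} {p : ℕ → ℕ → ℝ} {init : ℕ}
    (hμ : IsMarkovChain μ p init) (t : ℕ) (G : (Fin (t + 1) → ℕ) → ℝ≥0∞) (Φ : ℕ → ℝ≥0∞) :
    ∫⁻ ω, G (pathRestr t ω) * Φ (ω (t + 1)) ∂μ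
      = ∫⁻ ω, G (pathRestr t ω) * stepE p Φ (ω t) ∂μ := by
  have hr := measurable_pathRestr t
  have hpair : Measurable (fun ω : ℕ → ℕ => (pathRestr t ω, ω (t + 1))) :=
    hr.prodMk (measurable_pi_apply _)
  have h1 : ∫⁻ ω, G (pathRestr t ω) * Φ (ω (t + 1)) ∂μ
      = ∫⁻ z : (Fin (t + 1) → ℕ) × ℕ, G z.1 * Φ z.2
          ∂(μ.map (fun ω : ℕ → ℕ => (pathRestr t ω, ω (t + 1)))) := by
    rw [lintegral_map (measurable_of_countable _) hpair]
  have h2 : ∫⁻ ω, G (pathRestr t ω) * stepE p Φ (ω t) ∂μ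
      = ∫⁻ c : (Fin (t + 1) → ℕ), G c * stepE p Φ (c (Fin.last t)) ∂(μ.map (pathRestr t)) := by
    rw [lintegral_map (measurable_of_countable _) hr]
    rfl
  rw [h1, h2, lintegral_countable', lintegral_countable', ENNReal.tsum_prod']
  refine tsum_congr fun c => ?_
  have key : ∀ j, (μ.map (fun ω : ℕ → ℕ => (pathRestr t ω, ω (t + 1)))) {(c, j)}
      = ENNReal.ofReal (p (c (Fin.last t)) j) * (μ.map (pathRestr t)) {c} := by
    intro j
    rw [Measure.map_apply hpair (measurableSet_singleton _),
      Measure.map_apply hr (measurableSet_singleton _)]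
    have h := hμ.2 t (fun i => if h : i < t + 1 then c ⟨i, h⟩ else 0) j
    have e1 : {ω : ℕ → ℕ | ∀ i ≤ t, ω i = if h : i < t + 1 then c ⟨i, h⟩ else 0}
        = pathRestr t ⁻¹' {c} := by
      ext ω
      simp only [Set.mem_ofPred_eq, Set.mem_preimage, Set.mem_singleton_iff, funext_iff, pathRestr]
      constructor
      · intro h i
        have := h i (Nat.lt_succ_iff.mp i.2)
        rw [dif_pos i.2] at this
        exact this
      · intro h i hi
        rw [dif_pos (Nat.lt_succ_iff.mpr hi)]
        exact h ⟨i, Nat.lt_succ_iff.mpr hi⟩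
    have e2 : {ω : ℕ → ℕ | (∀ i ≤ t, ω i = if h : i < t + 1 then c ⟨i, h⟩ else 0)
          ∧ ω (t + 1) = j}
        = (fun ω : ℕ → ℕ => (pathRestr t ω, ω (t + 1))) ⁻¹' {(c, j)} := by
      have : {ω : ℕ → ℕ | (∀ i ≤ t, ω i = if h : i < t + 1 then c ⟨i, h⟩ else 0)
          ∧ ω (t + 1) = j} = {ω : ℕ → ℕ | ∀ i ≤ t, ω i = if h : i < t + 1 then c ⟨i, h⟩ else 0}
            ∩ {ω | ω (t + 1) = j} := rfl
      rw [this, e1]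
      ext ω
      simp
    rw [e1, e2] at h
    rw [h]
    simp [Fin.last]
  simp only [key, stepE]
  rw [mul_assoc, ← ENNReal.tsum_mul_right, ← ENNReal.tsum_mul_left]
  refine tsum_congr fun j => ?_
  ring

lemma measurableSet_coord (t : ℕ) (C : Set ℕ) : MeasurableSet {ω : ℕ → ℕ | ω t ∈ C} := by
  have h : MeasurableSet ((fun ω : ℕ → ℕ => ω t) ⁻¹' C) :=
    measurable_pi_apply t MeasurableSet.of_discrete
  exact h

/-- The event that `B` is not visited up to time `t`. -/
def avoid (B : Set ℕ) (t : ℕ) : Set (ℕ → ℕ) := {ω | ∀ s ≤ t, ω s ∉ B}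

lemma measurableSet_avoid (B : Set ℕ) (t : ℕ) : MeasurableSet (avoid B t) := by
  have : avoid B t = ⋂ s, ⋂ (_ : s ≤ t), {ω | ω s ∉ B} := by
    ext; simp [avoid]
  rw [this]
  refine MeasurableSet.iInter fun s => MeasurableSet.iInter fun _ => ?_
  exact measurableSet_coord s Bᶜ

lemma avoid_step {μ : Measure (ℕ → ℕ)} {p : ℕ → ℕ → ℝ} {init : ℕ}
    (hμ : IsMarkovChain μ p init) (t : ℕ) (B : Set ℕ) (Φ : ℕ → ℝ≥0∞) :
    ∫⁻ ω in avoid B t, Φ (ω (t + 1)) ∂μ = ∫⁻ ω in avoid B t, stepE p Φ (ω t) ∂μ := by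
  classical
  have h := markov_step hμ t (fun c => if ∀ i, c i ∉ B then 1 else 0) Φ
  have e : ∀ ω, (∀ i, pathRestr t ω i ∉ B) ↔ ω ∈ avoid B t := by
    intro ω
    constructor
    · intro h s hs
      exact h ⟨s, Nat.lt_succ_iff.mpr hs⟩
    · intro h i
      exact h i (Nat.lt_succ_iff.mp i.2)
  rw [← lintegral_indicator (measurableSet_avoid B t),
    ← lintegral_indicator (measurableSet_avoid B t)]
  simp only [e] at h
  simpa [Set.indicator_apply] using h

lemma avoid_init {μ : Measure (ℕ → ℕ)} [IsProbabilityMeasure μ] {p : ℕ → ℕ → ℝ} {init : ℕ}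
    (hμ : IsMarkovChain μ p init) : ∀ᵐ ω ∂μ, ω 0 = init := by
  have hm : MeasurableSet {ω : ℕ → ℕ | ω 0 = init} :=
    measurableSet_coord 0 {init}
  exact (mem_ae_iff_prob_eq_one hm).2 hμ.1

lemma avoid_zero_integral {μ : Measure (ℕ → ℕ)} [IsProbabilityMeasure μ] {p : ℕ → ℕ → ℝ}
    {init : ℕ} (hμ : IsMarkovChain μ p init) (B : Set ℕ) (hB : init ∉ B) (Φ : ℕ → ℝ≥0∞) :
    ∫⁻ ω in avoid B 0, Φ (ω 0) ∂μ = Φ init := by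
  have h0 := avoid_init hμ
  rw [← lintegral_indicator (measurableSet_avoid B 0)]
  have : ∀ᵐ ω ∂μ, (avoid B 0).indicator (fun ω => Φ (ω 0)) ω = Φ init := by
    filter_upwards [h0] with ω hω
    rw [Set.indicator_of_mem, hω]
    intro s hs
    obtain rfl : s = 0 := by omega
    rwa [hω]
  rw [lintegral_congr_ae this]
  simp

lemma avoid_mono (B : Set ℕ) {s t : ℕ} (h : s ≤ t) : avoid B t ⊆ avoid B s :=
  fun _ hω i hi => hω i (hi.trans h)

lemma avoid_iInter (B : Set ℕ) : {ω : ℕ → ℕ | ∀ t, ω t ∉ B} = ⋂ t, avoid B t := by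
  ext ω
  simp only [Set.mem_ofPred_eq, Set.mem_iInter, avoid]
  exact ⟨fun h t s _ => h s, fun h t => h t t le_rfl⟩

lemma prob_avoid_ge {μ : Measure (ℕ → ℕ)} [IsProbabilityMeasure μ] {p : ℕ → ℕ → ℝ}
    {init : ℕ} (hμ : IsMarkovChain μ p init) (B : Set ℕ) (hB : init ∉ B) (Φ : ℕ → ℝ≥0∞)
    (h1 : ∀ x, Φ x ≤ 1) (h0 : ∀ x ∈ B, Φ x = 0) (hs : ∀ x, x ∉ B → Φ x ≤ stepE p Φ x) :
    Φ init ≤ μ {ω | ∀ t, ω t ∉ B} := by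
  have hE : ∀ t, Φ init ≤ ∫⁻ ω in avoid B t, Φ (ω t) ∂μ := by
    intro t
    induction t with
    | zero => exact (avoid_zero_integral hμ B hB Φ).ge
    | succ t ih =>
      have e : ∫⁻ ω in avoid B (t + 1), Φ (ω (t + 1)) ∂μ
          = ∫⁻ ω in avoid B t, Φ (ω (t + 1)) ∂μ := by
        rw [← lintegral_indicator (measurableSet_avoid B _),
          ← lintegral_indicator (measurableSet_avoid B _)]
        congr 1
        ext ω
        by_cases hω : ω ∈ avoid B t
        · by_cases hb : ω (t + 1) ∈ B
          · classical
            rw [Set.indicator_apply, Set.indicator_apply, h0 _ hb]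
            simp
          · have : ω ∈ avoid B (t + 1) := by
              intro s hs
              rcases Nat.lt_or_ge s (t + 1) with h | h
              · exact hω s (by omega)
              · obtain rfl : s = t + 1 := by omega
                exact hb
            simp [hω, this]
        · have : ω ∉ avoid B (t + 1) := fun h => hω (avoid_mono B (Nat.le_succ t) h)
          simp [hω, this]
      rw [e, avoid_step hμ]
      refine ih.trans ?_
      refine setLIntegral_mono' (measurableSet_avoid B t) fun ω hω => ?_
      exact hs _ (hω t le_rfl)
  have hE2 : ∀ t, Φ init ≤ μ (avoid B t) := by
    intro t
    refine (hE t).trans ?_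
    calc ∫⁻ ω in avoid B t, Φ (ω t) ∂μ ≤ ∫⁻ _ in avoid B t, 1 ∂μ :=
          lintegral_mono fun ω => h1 _
      _ = μ (avoid B t) := by simp
  rw [avoid_iInter]
  have := tendsto_measure_iInter_atTop (μ := μ) (s := avoid B)
    (fun t => (measurableSet_avoid B t).nullMeasurableSet)
    (fun s t h => avoid_mono B h) ⟨0, measure_ne_top _ _⟩
  exact ge_of_tendsto' this hE2

lemma prob_avoid_le {μ : Measure (ℕ → ℕ)} [IsProbabilityMeasure μ] {p : ℕ → ℕ → ℝ}
    {init : ℕ} (hμ : IsMarkovChain μ p init) (B : Set ℕ) (hB : init ∉ B) (Φ : ℕ → ℝ≥0∞)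
    (hs : ∀ x, x ∉ B → stepE p Φ x ≤ Φ x)
    (htr : ∀ K, Tendsto (fun t => μ {ω : ℕ → ℕ | ω t ≤ K}) atTop (𝓝 0))
    (hlim : Tendsto Φ atTop (𝓝 1)) :
    μ {ω | ∀ t, ω t ∉ B} ≤ Φ init := by
  have hE : ∀ t, ∫⁻ ω in avoid B t, Φ (ω t) ∂μ ≤ Φ init := by
    intro t
    induction t with
    | zero => exact (avoid_zero_integral hμ B hB Φ).le
    | succ t ih =>
      calc ∫⁻ ω in avoid B (t + 1), Φ (ω (t + 1)) ∂μ
          ≤ ∫⁻ ω in avoid B t, Φ (ω (t + 1)) ∂μ :=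
            lintegral_mono_set (avoid_mono B (Nat.le_succ t))
        _ = _ := avoid_step hμ t B Φ
        _ ≤ ∫⁻ ω in avoid B t, Φ (ω t) ∂μ :=
            setLIntegral_mono' (measurableSet_avoid B t) fun ω hω => hs _ (hω t le_rfl)
        _ ≤ _ := ih
  set A : Set (ℕ → ℕ) := {ω | ∀ t, ω t ∉ B} with hA
  have hc : ∀ c : ℝ≥0∞, c < 1 → c * μ A ≤ Φ init := by
    intro c hc
    obtain ⟨K, hK⟩ := eventually_atTop.1 (hlim.eventually (lt_mem_nhds hc))
    have hb : ∀ t, c * μ A ≤ Φ init + c * μ {ω : ℕ → ℕ | ω t ≤ K} := by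
      intro t
      have hsub : A ⊆ (avoid B t ∩ {ω | K < ω t}) ∪ {ω | ω t ≤ K} := by
        intro ω hω
        rcases le_or_gt (ω t) K with h | h
        · exact Or.inr h
        · exact Or.inl ⟨fun s _ => hω s, h⟩
      have hm : MeasurableSet (avoid B t ∩ {ω : ℕ → ℕ | K < ω t}) :=
        (measurableSet_avoid B t).inter
          (measurableSet_coord t (Set.Ioi K))
      have h2 : c * μ (avoid B t ∩ {ω | K < ω t}) ≤ Φ init := by
        refine le_trans ?_ (hE t)
        calc c * μ (avoid B t ∩ {ω | K < ω t})
            = ∫⁻ _ in (avoid B t ∩ {ω | K < ω t}), c ∂μ := by simp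
          _ ≤ ∫⁻ ω in (avoid B t ∩ {ω | K < ω t}), Φ (ω t) ∂μ :=
            setLIntegral_mono' hm fun ω hω => (hK _ (le_of_lt hω.2)).le
          _ ≤ _ := lintegral_mono_set Set.inter_subset_left
      calc c * μ A ≤ c * (μ (avoid B t ∩ {ω | K < ω t}) + μ {ω | ω t ≤ K}) := by
            gcongr
            exact (measure_mono hsub).trans (measure_union_le _ _)
        _ = c * μ (avoid B t ∩ {ω | K < ω t}) + c * μ {ω | ω t ≤ K} := mul_add _ _ _
        _ ≤ _ := by gcongr
    have hl : Tendsto (fun t => Φ init + c * μ {ω : ℕ → ℕ | ω t ≤ K}) atTop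
        (𝓝 (Φ init + c * 0)) := by
      refine tendsto_const_nhds.add (ENNReal.Tendsto.const_mul (htr K) (Or.inr ?_))
      exact (hc.trans ENNReal.one_lt_top).ne
    have := ge_of_tendsto' hl hb
    simpa using this
  have hl : Tendsto (fun n : ℕ => (1 - ((n : ℝ≥0∞) + 1)⁻¹) * μ A) atTop (𝓝 ((1 - 0) * μ A)) := by
    refine ENNReal.Tendsto.mul_const (ENNReal.Tendsto.sub tendsto_const_nhds ?_ (Or.inl (by simp)))
      (Or.inr (measure_ne_top _ _))
    have := (tendsto_add_atTop_iff_nat 1).2 ENNReal.tendsto_inv_nat_nhds_zero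
    simpa using this
  have := le_of_tendsto' hl (fun n => hc _ (ENNReal.sub_lt_self (by simp) (by simp) (by simp)))
  simpa using this

lemma transient_of_super {μ : Measure (ℕ → ℕ)} [IsProbabilityMeasure μ] {p : ℕ → ℕ → ℝ}
    {init : ℕ} (hμ : IsMarkovChain μ p init) (Φ : ℕ → ℝ≥0∞) (hfin : Φ init ≠ ⊤)
    (K : ℕ) (δ : ℝ≥0∞) (hδ : δ ≠ 0) (hδ' : δ ≠ ⊤)
    (hs : ∀ x, stepE p Φ x + (if x ≤ K then δ else 0) ≤ Φ x) :
    Tendsto (fun t => μ {ω : ℕ → ℕ | ω t ≤ K}) atTop (𝓝 0) := by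
  have e0 : ∀ t, avoid (∅ : Set ℕ) t = Set.univ := by intro t; ext; simp [avoid]
  have hstep : ∀ t, ∫⁻ ω, Φ (ω (t + 1)) ∂μ = ∫⁻ ω, stepE p Φ (ω t) ∂μ := by
    intro t
    have := avoid_step hμ t ∅ Φ
    simpa [e0] using this
  have hE : ∀ T, ∫⁻ ω, Φ (ω T) ∂μ + ∑ t ∈ Finset.range T, δ * μ {ω : ℕ → ℕ | ω t ≤ K}
      ≤ Φ init := by
    intro T
    induction T with
    | zero =>
      have := avoid_zero_integral hμ ∅ (by simp) Φ
      simp only [e0, Measure.restrict_univ] at this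
      simp [this]
    | succ T ih =>
      rw [Finset.sum_range_succ, hstep]
      refine le_trans (le_of_eq ?_) (le_trans (add_le_add_left (?_ :
        ∫⁻ ω, stepE p Φ (ω T) ∂μ + δ * μ {ω : ℕ → ℕ | ω T ≤ K} ≤ ∫⁻ ω, Φ (ω T) ∂μ) _) ih)
      · ring
      · have hm : MeasurableSet {ω : ℕ → ℕ | ω T ≤ K} :=
          measurableSet_coord T (Set.Iic K)
        rw [← lintegral_indicator_const hm, ← lintegral_add_right _ (measurable_const.indicator hm)]
        refine lintegral_mono fun ω => ?_
        have := hs (ω T)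
        simpa [Set.indicator_apply] using this
  have hsum : ∑' t, δ * μ {ω : ℕ → ℕ | ω t ≤ K} ≠ ⊤ := by
    refine ne_top_of_le_ne_top hfin ?_
    rw [ENNReal.tsum_eq_iSup_nat]
    exact iSup_le fun T => le_trans le_add_self (hE T)
  have h := ENNReal.tendsto_atTop_zero_of_tsum_ne_top hsum
  have h2 := ENNReal.Tendsto.const_mul (a := δ⁻¹) h (Or.inr (by simpa using hδ))
  simp only [← mul_assoc, ENNReal.inv_mul_cancel hδ hδ', one_mul, mul_zero] at h2
  exact h2

/-- The standing hypotheses on the transition probabilities. -/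
structure WalkHyp (q p1 p2 : ℕ → ℝ) : Prop where
  hq : ∀ k, 2 ≤ k → 0 < q k
  hp1 : ∀ k, 2 ≤ k → 0 ≤ p1 k
  hp2 : ∀ k, 2 ≤ k → 0 < p2 k
  hsum : ∀ k, 2 ≤ k → q k + p1 k + p2 k = 1

/-- Real one-step operator of the walk. -/
def stepR (q p1 p2 : ℕ → ℝ) (g : ℕ → ℝ) (x : ℕ) : ℝ :=
  if x = 0 then g 2 else if x = 1 then g 0
  else q x * g (x - 1) + p1 x * g (x + 1) + p2 x * g (x + 2)

lemma stepR_of_two_le (q p1 p2 : ℕ → ℝ) (g : ℕ → ℝ) {x : ℕ} (hx : 2 ≤ x) :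
    stepR q p1 p2 g x = q x * g (x - 1) + p1 x * g (x + 1) + p2 x * g (x + 2) := by
  unfold stepR
  rw [if_neg (by omega), if_neg (by omega)]

lemma stepE_ofReal {q p1 p2 : ℕ → ℝ} (h : WalkHyp q p1 p2) (g : ℕ → ℝ) (hg : ∀ x, 0 ≤ g x)
    (x : ℕ) : stepE (transY q p1 p2) (fun y => ENNReal.ofReal (g y)) x
      = ENNReal.ofReal (stepR q p1 p2 g x) := by
  unfold stepE
  rcases Nat.lt_or_ge x 2 with hx | hx
  · interval_cases x
    · rw [tsum_eq_single 2]
      · simp [transY, stepR]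
      · intro j hj
        simp [transY, hj]
    · rw [tsum_eq_single 0]
      · simp [transY, stepR]
      · intro j hj
        simp [transY, hj]
  · rw [stepR_of_two_le _ _ _ _ hx]
    have hq := h.hq x hx
    have hp1 := h.hp1 x hx
    have hp2 := h.hp2 x hx
    rw [tsum_eq_sum (s := {x - 1, x + 1, x + 2})]
    · rw [Finset.sum_insert, Finset.sum_insert, Finset.sum_singleton]
      · rw [ENNReal.ofReal_add, ENNReal.ofReal_add, ENNReal.ofReal_mul hq.le,
          ENNReal.ofReal_mul hp1, ENNReal.ofReal_mul hp2.le]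
        · have e1 : transY q p1 p2 x (x - 1) = q x := by
            unfold transY
            rw [if_neg (by omega), if_neg (by omega), if_pos rfl]
          have e2 : transY q p1 p2 x (x + 1) = p1 x := by
            unfold transY
            rw [if_neg (by omega), if_neg (by omega), if_neg (by omega), if_pos rfl]
          have e3 : transY q p1 p2 x (x + 2) = p2 x := by
            unfold transY
            rw [if_neg (by omega), if_neg (by omega), if_neg (by omega), if_neg (by omega),
              if_pos rfl]
          rw [e1, e2, e3, add_assoc]
        · exact mul_nonneg hq.le (hg _)
        · exact mul_nonneg hp1 (hg _)
        · exact add_nonneg (mul_nonneg hq.le (hg _)) (mul_nonneg hp1 (hg _))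
        · exact mul_nonneg hp2.le (hg _)
      · simp
      · simp only [Finset.mem_insert, Finset.mem_singleton]
        omega
    · intro j hj
      simp only [Finset.mem_insert, Finset.mem_singleton, not_or] at hj
      have : transY q p1 p2 x j = 0 := by
        unfold transY
        rw [if_neg (by omega), if_neg (by omega), if_neg hj.1, if_neg hj.2.1, if_neg hj.2.2]
      simp [this]

lemma harm_of_diff {q p1 p2 : ℕ → ℝ} (h : WalkHyp q p1 p2) (φ : ℕ → ℝ) {x : ℕ} (hx : 2 ≤ x)
    (hd : φ x - φ (x - 1) = (p1 x + p2 x) / q x * (φ (x + 1) - φ x)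
      + p2 x / q x * (φ (x + 2) - φ (x + 1))) :
    q x * φ (x - 1) + p1 x * φ (x + 1) + p2 x * φ (x + 2) = φ x := by
  have hq := h.hq x hx
  have hs := h.hsum x hx
  have : q x * (φ x - φ (x - 1)) = (p1 x + p2 x) * (φ (x + 1) - φ x)
      + p2 x * (φ (x + 2) - φ (x + 1)) := by
    rw [hd]; field_simp
  linear_combination -this + φ x * hs

lemma prodAsc_step (q p1 p2 : ℕ → ℝ) {k n : ℕ} (h : k < n) :
    prodAsc q p1 p2 k n = Amat q p1 p2 k * prodAsc q p1 p2 (k + 1) n := by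
  unfold prodAsc
  obtain ⟨d, rfl⟩ := Nat.exists_eq_add_of_lt h
  have e1 : k + d + 1 - k = d + 1 := by omega
  have e2 : k + d + 1 - (k + 1) = d := by omega
  rw [e1, e2, List.range_succ_eq_map, List.map_cons, List.prod_cons, List.map_map]
  congr 2
  refine List.map_congr_left fun i _ => ?_
  simp only [Function.comp]
  congr 1
  omega

lemma prodAsc_self (q p1 p2 : ℕ → ℝ) {k n : ℕ} (h : n ≤ k) :
    prodAsc q p1 p2 k n = 1 := by
  unfold prodAsc
  rw [Nat.sub_eq_zero_of_le h]; simp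

lemma prodAsc_10 (q p1 p2 : ℕ → ℝ) {k n : ℕ} (h : k < n) :
    prodAsc q p1 p2 k n 1 0 = prodAsc q p1 p2 (k + 1) n 0 0 := by
  rw [prodAsc_step _ _ _ h]
  simp [Matrix.mul_apply, Amat]

lemma prodAsc_00 (q p1 p2 : ℕ → ℝ) {k n : ℕ} (h : k < n) :
    prodAsc q p1 p2 k n 0 0 = (p1 k + p2 k) / q k * prodAsc q p1 p2 (k + 1) n 0 0
      + p2 k / q k * prodAsc q p1 p2 (k + 1) n 1 0 := by
  rw [prodAsc_step _ _ _ h]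
  simp [Matrix.mul_apply, Amat]

lemma a_pos {q p1 p2 : ℕ → ℝ} (h : WalkHyp q p1 p2) {k : ℕ} (hk : 2 ≤ k) :
    0 < (p1 k + p2 k) / q k :=
  div_pos (add_pos_of_nonneg_of_pos (h.hp1 k hk) (h.hp2 k hk)) (h.hq k hk)

lemma b_pos {q p1 p2 : ℕ → ℝ} (h : WalkHyp q p1 p2) {k : ℕ} (hk : 2 ≤ k) :
    0 < p2 k / q k := div_pos (h.hp2 k hk) (h.hq k hk)

lemma b_le_a {q p1 p2 : ℕ → ℝ} (h : WalkHyp q p1 p2) {k : ℕ} (hk : 2 ≤ k) :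
    p2 k / q k ≤ (p1 k + p2 k) / q k := by
  have := h.hq k hk
  have := h.hp1 k hk
  gcongr
  linarith

lemma prodAsc_pos {q p1 p2 : ℕ → ℝ} (h : WalkHyp q p1 p2) (d : ℕ) :
    ∀ k n, 2 ≤ k → n - k = d → 0 < prodAsc q p1 p2 k n 0 0 ∧ 0 ≤ prodAsc q p1 p2 k n 1 0 := by
  induction d with
  | zero =>
    intro k n _ hd
    rw [prodAsc_self _ _ _ (by omega)]
    simp
  | succ d ih =>
    intro k n hk hd
    obtain ⟨h1, h2⟩ := ih (k + 1) n (by omega) (by omega)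
    rw [prodAsc_10 _ _ _ (by omega), prodAsc_00 _ _ _ (by omega : k < n)]
    exact ⟨add_pos_of_pos_of_nonneg (mul_pos (a_pos h hk) h1) (mul_nonneg (b_pos h hk).le h2),
      h1.le⟩

lemma zetaApprox_rec {q p1 p2 : ℕ → ℝ} (h : WalkHyp q p1 p2) {k n : ℕ} (hk : 2 ≤ k)
    (hn : k + 1 ≤ n) : zetaApprox q p1 p2 k n *
      ((p1 k + p2 k) / q k + p2 k / q k * zetaApprox q p1 p2 (k + 1) n) = 1 := by
  unfold zetaApprox
  have h1 := (prodAsc_pos h _ k (n + 1) hk rfl).1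
  have h2 := (prodAsc_pos h _ (k + 1) (n + 1) (by omega) rfl).1
  have e := prodAsc_00 q p1 p2 (by omega : k < n + 1)
  rw [prodAsc_10 _ _ _ (by omega)] at e
  set X := prodAsc q p1 p2 k (n + 1) 0 0
  set Y := prodAsc q p1 p2 (k + 1) (n + 1) 0 0
  set Z := prodAsc q p1 p2 (k + 1 + 1) (n + 1) 0 0
  generalize (p1 k + p2 k) / q k = A at *
  generalize p2 k / q k = B at *
  field_simp
  linarith

lemma zeta_rec {q p1 p2 : ℕ → ℝ} (h : WalkHyp q p1 p2) {ζ : ℕ → ℝ}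
    (hζ : ∀ k, 2 ≤ k → Tendsto (fun n => zetaApprox q p1 p2 k n) atTop (𝓝 (ζ k)))
    {k : ℕ} (hk : 2 ≤ k) :
    ζ k * ((p1 k + p2 k) / q k + p2 k / q k * ζ (k + 1)) = 1 := by
  have h1 := (hζ k hk).mul ((tendsto_const_nhds (x := (p1 k + p2 k) / q k)).add
    ((tendsto_const_nhds (x := p2 k / q k)).mul (hζ (k + 1) (by omega))))
  refine tendsto_nhds_unique h1 (tendsto_const_nhds.congr' ?_)
  filter_upwards [eventually_ge_atTop (k + 1)] with n hn
  exact (zetaApprox_rec h hk hn).symm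

lemma zeta_pos {q p1 p2 : ℕ → ℝ} (h : WalkHyp q p1 p2) {ζ : ℕ → ℝ}
    (hζ : ∀ k, 2 ≤ k → Tendsto (fun n => zetaApprox q p1 p2 k n) atTop (𝓝 (ζ k)))
    {k : ℕ} (hk : 2 ≤ k) : 0 < ζ k := by
  have h1 : 0 ≤ ζ k := ge_of_tendsto' (hζ k hk) fun n =>
    div_nonneg (prodAsc_pos h _ (k + 1) (n + 1) (by omega) rfl).1.le
      (prodAsc_pos h _ k (n + 1) hk rfl).1.le
  have h2 := zeta_rec h hζ hk
  rcases h1.lt_or_eq with h3 | h3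
  · exact h3
  · rw [← h3] at h2; simp at h2

/-- Core limit lemma: a recursion `x_k (α_k + γ_k y_k) = β_k`. -/
lemma core_limsup {x y α γ β : ℕ → ℝ} {a g c U L : ℝ} (hx : ∀ᶠ k in atTop, 0 ≤ x k)
    (hg : 0 ≤ g) (hγ : ∀ᶠ k in atTop, 0 ≤ γ k)
    (hα : Tendsto α atTop (𝓝 a)) (hγl : Tendsto γ atTop (𝓝 g)) (hβ : Tendsto β atTop (𝓝 c))
    (hrec : ∀ᶠ k in atTop, x k * (α k + γ k * y k) = β k)
    (ha : 0 < a) (hL0 : 0 ≤ L)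
    (hU : ∀ M < U, ∃ᶠ k in atTop, M < x k) (hL : ∀ M < L, ∀ᶠ k in atTop, M < y k) :
    U * (a + g * L) ≤ c := by
  -- for all small ε
  have main : ∀ M < U, ∀ M' < L, M * (a + g * M') ≤ c ∨ a + g * M' ≤ 0 := by
    intro M hM M' hM'
    rcases le_or_gt (a + g * M') 0 with h0 | h0
    · exact Or.inr h0
    left
    have hlim : Tendsto (fun k => β k - M * (α k + γ k * M')) atTop
        (𝓝 (c - M * (a + g * M'))) :=
      hβ.sub (tendsto_const_nhds.mul (hα.add (hγl.mul tendsto_const_nhds)))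
    have hpos : ∀ᶠ k in atTop, 0 < α k + γ k * M' :=
      (hα.add (hγl.mul_const M')).eventually (lt_mem_nhds h0)
    have hfr : ∃ᶠ k in atTop, 0 ≤ β k - M * (α k + γ k * M') := by
      refine ((hU M hM).and_eventually
        (hpos.and (hx.and (hγ.and (hrec.and (hL M' hM')))))).mono ?_
      rintro k ⟨h1, h2, h3, h4, h5, h6⟩
      rw [← h5]
      have : α k + γ k * M' ≤ α k + γ k * y k := by gcongr
      have h7 : x k * (α k + γ k * M') ≤ x k * (α k + γ k * y k) := by gcongr
      nlinarith
    have := ge_of_tendsto_of_frequently hlim hfr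
    linarith
  have hl : Tendsto (fun ε : ℝ => (U - ε) * (a + g * (L - ε))) (𝓝[>] 0)
      (𝓝 ((U - 0) * (a + g * (L - 0)))) := by
    refine Tendsto.mono_left ?_ nhdsWithin_le_nhds
    have : Continuous (fun ε : ℝ => (U - ε) * (a + g * (L - ε))) := by fun_prop
    exact this.tendsto 0
  have hl2 : Tendsto (fun ε : ℝ => a + g * (L - ε)) (𝓝[>] 0) (𝓝 (a + g * (L - 0))) := by
    refine Tendsto.mono_left ?_ nhdsWithin_le_nhds
    have : Continuous (fun ε : ℝ => a + g * (L - ε)) := by fun_prop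
    exact this.tendsto 0
  simp only [sub_zero] at hl hl2
  have hpos : 0 < a + g * L := by positivity
  refine le_of_tendsto hl ?_
  filter_upwards [self_mem_nhdsWithin, hl2.eventually (lt_mem_nhds hpos)] with ε hε h2
  have hε' : 0 < ε := hε
  rcases main (U - ε) (by linarith) (L - ε) (by linarith) with h | h
  · exact h
  · linarith

lemma core_liminf {x y α γ β : ℕ → ℝ} {a g c U L : ℝ} (hx : ∀ᶠ k in atTop, 0 ≤ x k)
    (hg : 0 ≤ g) (hγ : ∀ᶠ k in atTop, 0 ≤ γ k)
    (hα : Tendsto α atTop (𝓝 a)) (hγl : Tendsto γ atTop (𝓝 g)) (hβ : Tendsto β atTop (𝓝 c))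
    (hrec : ∀ᶠ k in atTop, x k * (α k + γ k * y k) = β k)
    (ha : 0 < a) (hU0 : 0 ≤ U)
    (hL : ∀ M, L < M → ∃ᶠ k in atTop, x k < M) (hU : ∀ M, U < M → ∀ᶠ k in atTop, y k < M) :
    c ≤ L * (a + g * U) := by
  have main : ∀ M, L < M → ∀ M', U < M' → c ≤ M * (a + g * M') := by
    intro M hM M' hM'
    have h0 : 0 < a + g * M' := by
      have : 0 < M' := by linarith
      positivity
    have hlim : Tendsto (fun k => M * (α k + γ k * M') - β k) atTop
        (𝓝 (M * (a + g * M') - c)) :=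
      (tendsto_const_nhds.mul (hα.add (hγl.mul tendsto_const_nhds))).sub hβ
    have hpos : ∀ᶠ k in atTop, 0 < α k + γ k * M' :=
      (hα.add (hγl.mul_const M')).eventually (lt_mem_nhds h0)
    have hfr : ∃ᶠ k in atTop, 0 ≤ M * (α k + γ k * M') - β k := by
      refine ((hL M hM).and_eventually
        (hpos.and (hx.and (hγ.and (hrec.and (hU M' hM')))))).mono ?_
      rintro k ⟨h1, h2, h3, h4, h5, h6⟩
      rw [← h5]
      have : α k + γ k * y k ≤ α k + γ k * M' := by gcongr
      have h7 : x k * (α k + γ k * y k) ≤ x k * (α k + γ k * M') := by gcongr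
      nlinarith
    have := ge_of_tendsto_of_frequently hlim hfr
    linarith
  have hl : Tendsto (fun ε : ℝ => (L + ε) * (a + g * (U + ε))) (𝓝[>] 0)
      (𝓝 ((L + 0) * (a + g * (U + 0)))) := by
    refine Tendsto.mono_left ?_ nhdsWithin_le_nhds
    have : Continuous (fun ε : ℝ => (L + ε) * (a + g * (U + ε))) := by fun_prop
    exact this.tendsto 0
  simp only [add_zero] at hl
  refine ge_of_tendsto hl ?_
  filter_upwards [self_mem_nhdsWithin] with ε hε
  have hε' : 0 < ε := hε
  exact main _ (by linarith) _ (by linarith)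

/-- A bounded nonnegative sequence with a shift recursion converges. -/
lemma core_tendsto {z x y α γ β : ℕ → ℝ} {a g c C : ℝ} (i j : ℕ)
    (hxz : ∀ k, x k = z (k + i)) (hyz : ∀ k, y k = z (k + j))
    (hz : ∀ᶠ k in atTop, 0 ≤ z k) (hzC : ∀ᶠ k in atTop, z k ≤ C)
    (hg : 0 ≤ g) (hγ : ∀ᶠ k in atTop, 0 ≤ γ k)
    (hα : Tendsto α atTop (𝓝 a)) (hγl : Tendsto γ atTop (𝓝 g)) (hβ : Tendsto β atTop (𝓝 c))
    (hrec : ∀ᶠ k in atTop, x k * (α k + γ k * y k) = β k) (ha : 0 < a) :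
    ∃ l, 0 ≤ l ∧ l * (a + g * l) = c ∧ Tendsto z atTop (𝓝 l) := by
  have hbu : IsBoundedUnder (· ≤ ·) atTop z := ⟨C, by simpa using hzC⟩
  have hbl : IsBoundedUnder (· ≥ ·) atTop z := ⟨0, by simpa using hz⟩
  set U := limsup z atTop with hU
  set L := liminf z atTop with hL
  have hUf : ∀ M < U, ∃ᶠ k in atTop, M < z k := fun M hM =>
    frequently_lt_of_lt_limsup hbl.isCoboundedUnder_le hM
  have hUe : ∀ M, U < M → ∀ᶠ k in atTop, z k < M := fun M hM =>
    eventually_lt_of_limsup_lt hM hbu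
  have hLf : ∀ M, L < M → ∃ᶠ k in atTop, z k < M := fun M hM =>
    frequently_lt_of_liminf_lt hbu.isCoboundedUnder_ge hM
  have hLe : ∀ M < L, ∀ᶠ k in atTop, M < z k := fun M hM =>
    eventually_lt_of_lt_liminf hM hbl
  have hL0 : 0 ≤ L := le_liminf_of_le hbu.isCoboundedUnder_ge hz
  have hLU : L ≤ U := liminf_le_limsup hbu hbl
  have shE : ∀ (P : ℕ → Prop) (i : ℕ), (∀ᶠ k in atTop, P k) → ∀ᶠ k in atTop, P (k + i) :=
    fun P i h => (tendsto_add_atTop_nat i).eventually h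
  have shF : ∀ (P : ℕ → Prop) (i : ℕ), (∃ᶠ k in atTop, P k) → ∃ᶠ k in atTop, P (k + i) := by
    intro P i h hn
    apply h
    rw [eventually_atTop] at hn ⊢
    obtain ⟨N, hN⟩ := hn
    refine ⟨N + i, fun k hk => ?_⟩
    have : ¬ P (k - i + i) := hN (k - i) (by omega)
    rwa [Nat.sub_add_cancel (by omega)] at this
  have hx0 : ∀ᶠ k in atTop, 0 ≤ x k := by simp only [hxz]; exact shE _ i hz
  have h1 : U * (a + g * L) ≤ c := by
    refine core_limsup hx0 hg hγ hα hγl hβ hrec ha hL0 ?_ ?_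
    · intro M hM; simp only [hxz]; exact shF (fun k => M < z k) i (hUf M hM)
    · intro M hM; simp only [hyz]; exact shE (fun k => M < z k) j (hLe M hM)
  have h2 : c ≤ L * (a + g * U) := by
    refine core_liminf hx0 hg hγ hα hγl hβ hrec ha (hL0.trans hLU) ?_ ?_
    · intro M hM; simp only [hxz]; exact shF (fun k => z k < M) i (hLf M hM)
    · intro M hM; simp only [hyz]; exact shE (fun k => z k < M) j (hUe M hM)
  have hUL : U = L := by
    refine le_antisymm ?_ hLU
    have : a * U ≤ a * L := by nlinarith
    exact le_of_mul_le_mul_left this ha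
  refine ⟨L, hL0, ?_, tendsto_of_liminf_eq_limsup rfl hUL hbu hbl⟩
  rw [hUL] at h1 h2
  exact le_antisymm h1 h2

/-- Increments of the increasing harmonic function. -/
def ff (ζ : ℕ → ℝ) (j : ℕ) : ℝ := ∏ i ∈ Finset.Icc 2 j, ζ i

/-- The increasing harmonic function. -/
def HH (ζ : ℕ → ℝ) (x : ℕ) : ℝ := ∑ j ∈ Finset.Ico 1 x, ff ζ j

/-- The ratio `- D_{x-1} / D_x`. -/
def SS (q p1 p2 : ℕ → ℝ) : ℕ → ℝ
  | 0 => 0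
  | (k + 1) => if k < 2 then 0 else (p2 k / q k) / ((p1 k + p2 k) / q k + SS q p1 p2 k)

/-- Increments of the oscillating harmonic function. -/
def DD (q p1 p2 : ℕ → ℝ) : ℕ → ℝ
  | 0 => 0
  | (k + 1) => if k = 0 then 0 else if k = 1 then 1 else
      - DD q p1 p2 k * ((p1 k + p2 k) / q k + SS q p1 p2 k) / (p2 k / q k)

/-- The oscillating harmonic function. -/
def KK (q p1 p2 : ℕ → ℝ) (x : ℕ) : ℝ := ∑ j ∈ Finset.range x, DD q p1 p2 j

/-- Probability, from `x ≤ l`, of jumping over `l`. -/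
def tau (q p1 p2 : ℕ → ℝ) (x l : ℕ) : ℝ := (KK q p1 p2 x - KK q p1 p2 l) / DD q p1 p2 l

lemma ff_succ (ζ : ℕ → ℝ) {j : ℕ} (hj : 1 ≤ j) : ff ζ (j + 1) = ff ζ j * ζ (j + 1) := by
  unfold ff
  rw [Finset.prod_Icc_succ_top (by omega)]

lemma ff_one (ζ : ℕ → ℝ) : ff ζ 1 = 1 := by simp [ff]

lemma ff_pos {ζ : ℕ → ℝ} (hpos : ∀ k, 2 ≤ k → 0 < ζ k) (j : ℕ) : 0 < ff ζ j :=
  Finset.prod_pos fun i hi => hpos i (Finset.mem_Icc.1 hi).1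

lemma HH_zero (ζ : ℕ → ℝ) : HH ζ 0 = 0 := by simp [HH]
lemma HH_one (ζ : ℕ → ℝ) : HH ζ 1 = 0 := by simp [HH]

lemma HH_succ (ζ : ℕ → ℝ) {x : ℕ} (hx : 1 ≤ x) : HH ζ (x + 1) = HH ζ x + ff ζ x := by
  unfold HH
  rw [Finset.sum_Ico_succ_top hx]

lemma HH_mono {ζ : ℕ → ℝ} (hpos : ∀ k, 2 ≤ k → 0 < ζ k) : Monotone (HH ζ) := by
  refine monotone_nat_of_le_succ fun x => ?_
  rcases Nat.eq_zero_or_pos x with rfl | hx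
  · simp [HH_zero, HH_one]
  · rw [HH_succ ζ hx]
    linarith [ff_pos hpos x]

lemma HH_lt {ζ : ℕ → ℝ} (hpos : ∀ k, 2 ≤ k → 0 < ζ k) {x y : ℕ} (hx : 1 ≤ x) (hxy : x < y) :
    HH ζ x < HH ζ y := by
  have h1 := HH_mono hpos (Nat.succ_le_of_lt hxy)
  have h2 := HH_succ ζ hx
  have := ff_pos hpos x
  simp only [Nat.succ_eq_add_one] at h1
  linarith

lemma ff_split (ζ : ℕ → ℝ) {m : ℕ} (hm : 1 ≤ m) (j : ℕ) (hj : m ≤ j) :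
    ff ζ j = ff ζ m * ∏ i ∈ Finset.Icc (m + 1) j, ζ i := by
  induction j, hj using Nat.le_induction with
  | base => simp
  | succ j hj ih =>
    rw [ff_succ ζ (by omega), ih, Finset.prod_Icc_succ_top (by omega), mul_assoc]

lemma FYfin_mul (ζ : ℕ → ℝ) {m : ℕ} (hm : 1 ≤ m) (n : ℕ) (hn : m + 1 ≤ n) :
    ff ζ m * FYfin ζ m n = HH ζ n - HH ζ m := by
  induction n, hn using Nat.le_induction with
  | base => simp [FYfin, HH_succ ζ hm]
  | succ n hn ih =>
    have : FYfin ζ m (n + 1) = FYfin ζ m n + ∏ i ∈ Finset.Icc (m + 1) n, ζ i := by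
      unfold FYfin
      obtain ⟨d, rfl⟩ : ∃ d, n = d + 1 := ⟨n - 1, by omega⟩
      simp only [Nat.add_sub_cancel]
      rw [Finset.sum_Icc_succ_top (by omega)]
      ring
    rw [this, mul_add, ih, ← ff_split ζ hm n (by omega), HH_succ ζ (by omega)]
    ring

lemma HH_diff {q p1 p2 : ℕ → ℝ} {ζ : ℕ → ℝ}
    (hrec : ∀ k, 2 ≤ k → ζ k * ((p1 k + p2 k) / q k + p2 k / q k * ζ (k + 1)) = 1)
    {x : ℕ} (hx : 2 ≤ x) :
    HH ζ x - HH ζ (x - 1) = (p1 x + p2 x) / q x * (HH ζ (x + 1) - HH ζ x)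
      + p2 x / q x * (HH ζ (x + 2) - HH ζ (x + 1)) := by
  obtain ⟨y, rfl⟩ : ∃ y, x = y + 1 := ⟨x - 1, by omega⟩
  have hy : 1 ≤ y := by omega
  have e1 := HH_succ ζ hy
  have e2 := HH_succ ζ (by omega : 1 ≤ y + 1)
  have e3 := HH_succ ζ (by omega : 1 ≤ y + 2)
  have f1 := ff_succ ζ hy
  have f2 := ff_succ ζ (by omega : 1 ≤ y + 1)
  have hr := hrec (y + 1) hx
  simp only [Nat.add_sub_cancel]
  rw [show y + 1 + 2 = y + 2 + 1 from rfl, e3, show y + 1 + 1 = y + 2 from rfl,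
    show HH ζ (y + 2) = HH ζ (y + 1) + ff ζ (y + 1) from e2, e1,
    show ff ζ (y + 2) = ff ζ (y + 1) * ζ (y + 2) from f2, f1]
  rw [show y + 1 + 1 = y + 2 from rfl] at hr
  linear_combination (-ff ζ y) * hr

section osc
variable {q p1 p2 : ℕ → ℝ}

lemma SS_succ {k : ℕ} (hk : 2 ≤ k) :
    SS q p1 p2 (k + 1) = (p2 k / q k) / ((p1 k + p2 k) / q k + SS q p1 p2 k) := by
  rw [SS, if_neg (by omega)]

lemma SS_two : SS q p1 p2 2 = 0 := by rw [SS, if_pos (by omega)]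

lemma SS_bounds (h : WalkHyp q p1 p2) (k : ℕ) (hk : 2 ≤ k) :
    0 ≤ SS q p1 p2 k ∧ SS q p1 p2 k ≤ 1 := by
  induction k, hk using Nat.le_induction with
  | base => rw [SS_two]; norm_num
  | succ k hk ih =>
    rw [SS_succ hk]
    have := a_pos h hk
    have := b_pos h hk
    have := b_le_a h hk
    have := ih.1
    constructor
    · positivity
    · rw [div_le_one (by positivity)]; linarith

lemma SS_rec (h : WalkHyp q p1 p2) {k : ℕ} (hk : 2 ≤ k) :
    SS q p1 p2 (k + 1) * ((p1 k + p2 k) / q k + 1 * SS q p1 p2 k) = p2 k / q k := by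
  rw [SS_succ hk, one_mul]
  have := a_pos h hk
  have := (SS_bounds h k hk).1
  exact div_mul_cancel₀ _ (by positivity)

lemma SS_pos (h : WalkHyp q p1 p2) {k : ℕ} (hk : 2 ≤ k) : 0 < SS q p1 p2 (k + 1) := by
  rw [SS_succ hk]
  have := a_pos h hk
  have := b_pos h hk
  have := (SS_bounds h k hk).1
  positivity

lemma DD_succ {k : ℕ} (hk : 2 ≤ k) : DD q p1 p2 (k + 1) =
    - DD q p1 p2 k * ((p1 k + p2 k) / q k + SS q p1 p2 k) / (p2 k / q k) := by
  rw [DD, if_neg (by omega), if_neg (by omega)]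

lemma DD_zero : DD q p1 p2 0 = 0 := by rw [DD]
lemma DD_one : DD q p1 p2 1 = 0 := by rw [DD, if_pos rfl]
lemma DD_two : DD q p1 p2 2 = 1 := by rw [DD, if_neg (by omega), if_pos rfl]

lemma DD_ne (h : WalkHyp q p1 p2) (k : ℕ) (hk : 2 ≤ k) : DD q p1 p2 k ≠ 0 := by
  induction k, hk using Nat.le_induction with
  | base => rw [DD_two]; norm_num
  | succ k hk ih =>
    rw [DD_succ hk]
    have := a_pos h hk
    have := b_pos h hk
    have := (SS_bounds h k hk).1
    have h2 : (p1 k + p2 k) / q k + SS q p1 p2 k ≠ 0 := by positivity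
    exact div_ne_zero (mul_ne_zero (neg_ne_zero.2 ih) h2) (by positivity)

lemma DD_SS (h : WalkHyp q p1 p2) {k : ℕ} (hk : 1 ≤ k) :
    DD q p1 p2 (k + 1) * SS q p1 p2 (k + 1) = - DD q p1 p2 k := by
  rcases Nat.lt_or_ge k 2 with h2 | h2
  · obtain rfl : k = 1 := by omega
    rw [SS_two, DD_one]; simp
  · rw [DD_succ h2, SS_succ h2]
    have := a_pos h h2
    have hb := b_pos h h2
    have := (SS_bounds h k h2).1
    have h2 : (p1 k + p2 k) / q k + SS q p1 p2 k ≠ 0 := by positivity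
    generalize (p1 k + p2 k) / q k + SS q p1 p2 k = A at *
    generalize p2 k / q k = B at *
    field_simp

lemma KK_succ (x : ℕ) : KK q p1 p2 (x + 1) = KK q p1 p2 x + DD q p1 p2 x := by
  unfold KK; rw [Finset.sum_range_succ]

lemma KK_small {x : ℕ} (hx : x ≤ 2) : KK q p1 p2 x = 0 := by
  have h0 : KK q p1 p2 0 = 0 := by simp [KK]
  have h1 : KK q p1 p2 1 = 0 := by rw [KK_succ, h0, DD_zero]; simp
  have h2 : KK q p1 p2 2 = 0 := by rw [KK_succ, h1, DD_one]; simp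
  interval_cases x <;> assumption

lemma KK_diff (h : WalkHyp q p1 p2) {x : ℕ} (hx : 2 ≤ x) :
    KK q p1 p2 x - KK q p1 p2 (x - 1) = (p1 x + p2 x) / q x * (KK q p1 p2 (x + 1) - KK q p1 p2 x)
      + p2 x / q x * (KK q p1 p2 (x + 2) - KK q p1 p2 (x + 1)) := by
  obtain ⟨y, rfl⟩ : ∃ y, x = y + 1 := ⟨x - 1, by omega⟩
  have hy : 1 ≤ y := by omega
  simp only [Nat.add_sub_cancel]
  rw [show y + 1 + 2 = y + 2 + 1 from rfl, KK_succ (y + 2), show y + 1 + 1 = y + 2 from rfl,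
    show KK q p1 p2 (y + 2) = KK q p1 p2 (y + 1) + DD q p1 p2 (y + 1) from KK_succ (y + 1),
    KK_succ y]
  have h1 := DD_SS h hy
  have h2 : DD q p1 p2 (y + 2) = _ := DD_succ (q := q) (p1 := p1) (p2 := p2) hx
  have hb := (b_pos h hx).ne'
  rw [h2]
  generalize (p1 (y + 1) + p2 (y + 1)) / q (y + 1) = A at *
  generalize p2 (y + 1) / q (y + 1) = B at *
  field_simp
  linear_combination h1

lemma tau_self (l : ℕ) : tau q p1 p2 l l = 0 := by simp [tau]

lemma tau_succ_self (h : WalkHyp q p1 p2) {l : ℕ} (hl : 2 ≤ l) :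
    tau q p1 p2 (l + 1) l = 1 := by
  unfold tau
  rw [KK_succ, add_sub_cancel_left, div_self (DD_ne h l hl)]

lemma tau_rec (h : WalkHyp q p1 p2) (x : ℕ) {l : ℕ} (hl : 2 ≤ l) :
    tau q p1 p2 x (l + 1) = SS q p1 p2 (l + 1) * (1 - tau q p1 p2 x l) := by
  unfold tau
  have h1 := DD_ne h l hl
  have h2 := DD_ne h (l + 1) (by omega)
  have h3 := DD_SS h (by omega : 1 ≤ l)
  rw [KK_succ]
  field_simp
  linear_combination -(DD q p1 p2 l - (KK q p1 p2 x - KK q p1 p2 l)) * h3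

lemma tau_bounds (h : WalkHyp q p1 p2) (l : ℕ) (hl : 2 ≤ l) :
    ∀ x ≤ l, 0 ≤ tau q p1 p2 x l ∧ tau q p1 p2 x l ≤ 1 := by
  induction l, hl using Nat.le_induction with
  | base => intro x hx; simp [tau, KK_small hx, KK_small le_rfl]
  | succ l hl ih =>
    intro x hx
    rcases Nat.lt_or_ge x (l + 1) with h1 | h1
    · have h2 := ih x (by omega)
      have h3 := SS_bounds h (l + 1) (by omega)
      rw [tau_rec h x hl]
      constructor
      · exact mul_nonneg h3.1 (by linarith)
      · nlinarith
    · obtain rfl : x = l + 1 := by omega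
      rw [tau_self]; norm_num

lemma tau_le_SS (h : WalkHyp q p1 p2) {l : ℕ} (hl : 2 ≤ l) {x : ℕ} (hx : x ≤ l) :
    tau q p1 p2 x (l + 1) ≤ SS q p1 p2 (l + 1) := by
  rw [tau_rec h x hl]
  have h2 := tau_bounds h l hl x hx
  have h3 := SS_bounds h (l + 1) (by omega)
  nlinarith

/-- Linear combinations of the two harmonic functions are harmonic. -/
lemma harm_comb (h : WalkHyp q p1 p2) {ζ : ℕ → ℝ}
    (hrec : ∀ k, 2 ≤ k → ζ k * ((p1 k + p2 k) / q k + p2 k / q k * ζ (k + 1)) = 1)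
    (A B n : ℝ) (φ : ℕ → ℝ) {x : ℕ} (hx : 2 ≤ x)
    (hφ : ∀ y, x - 1 ≤ y → y ≤ x + 2 → φ y = A * HH ζ y + B * KK q p1 p2 y + n) :
    stepR q p1 p2 φ x = φ x := by
  rw [stepR_of_two_le _ _ _ _ hx]
  refine harm_of_diff h φ hx ?_
  rw [hφ x (by omega) (by omega), hφ (x - 1) (by omega) (by omega), hφ (x + 1) (by omega)
    (by omega), hφ (x + 2) (by omega) (by omega)]
  linear_combination A * HH_diff hrec hx + B * KK_diff h hx

/-- Minimum principle. -/
lemma min_principle (h : WalkHyp q p1 p2) (u : ℕ → ℝ) {n l : ℕ} (hn : 1 ≤ n) (hnl : n ≤ l)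
    (hu : ∀ x, n < x → x < l → q x * u (x - 1) + p1 x * u (x + 1) + p2 x * u (x + 2) = u x)
    (h0 : 0 ≤ u n) (h1 : 0 ≤ u l) (h2 : 0 ≤ u (l + 1)) :
    ∀ x, n ≤ x → x ≤ l + 1 → 0 ≤ u x := by
  obtain ⟨x0, hx0, hmin⟩ := Finset.exists_min_image (Finset.Icc n (l + 1)) u
    ⟨n, Finset.mem_Icc.2 ⟨le_rfl, by omega⟩⟩
  have key : ∀ x, n ≤ x → x ≤ l + 1 → u x ≤ u x0 → 0 ≤ u x0 := by
    intro x hx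
    induction x, hx using Nat.le_induction with
    | base => intro _ h; linarith
    | succ x hx ih =>
      intro hxl hle
      rcases Nat.lt_or_ge (x + 1) l with h3 | h3
      · have hh := hu (x + 1) (by omega) h3
        have m1 := hmin (x + 1 + 1) (Finset.mem_Icc.2 ⟨by omega, by omega⟩)
        have m2 := hmin (x + 1 + 2) (Finset.mem_Icc.2 ⟨by omega, by omega⟩)
        have hq := h.hq (x + 1) (by omega)
        have hp1 := h.hp1 (x + 1) (by omega)
        have hp2 := h.hp2 (x + 1) (by omega)
        have hs := h.hsum (x + 1) (by omega)
        simp only [Nat.add_sub_cancel] at hh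
        apply ih (by omega)
        by_contra hc
        push Not at hc
        have t1 := mul_lt_mul_of_pos_left hc hq
        have t2 := mul_le_mul_of_nonneg_left m1 hp1
        have t3 := mul_le_mul_of_nonneg_left m2 hp2.le
        have t4 : q (x + 1) * u x0 + p1 (x + 1) * u x0 + p2 (x + 1) * u x0 = u x0 := by
          linear_combination u x0 * hs
        linarith
      · rcases (by omega : x + 1 = l ∨ x + 1 = l + 1) with h4 | h4
        · rw [h4] at hle; linarith
        · rw [h4] at hle; linarith
  have h5 := key x0 (Finset.mem_Icc.1 hx0).1 (Finset.mem_Icc.1 hx0).2 le_rfl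
  intro x hx1 hx2
  exact h5.trans (hmin x (Finset.mem_Icc.2 ⟨hx1, hx2⟩))

end osc

section prob
variable {q p1 p2 : ℕ → ℝ}

lemma walk_transient (h : WalkHyp q p1 p2) {ζ : ℕ → ℝ} (hpos : ∀ k, 2 ≤ k → 0 < ζ k)
    (hrec : ∀ k, 2 ≤ k → ζ k * ((p1 k + p2 k) / q k + p2 k / q k * ζ (k + 1)) = 1)
    {μ : Measure (ℕ → ℕ)} [IsProbabilityMeasure μ]
    (hμ : IsMarkovChain μ (transY q p1 p2) 2) {I : ℝ} (hI : ∀ x, HH ζ x ≤ I) (K : ℕ) :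
    Tendsto (fun t => μ {ω : ℕ → ℕ | ω t ≤ K}) atTop (𝓝 0) := by
  set w : ℕ → ℝ := fun x => if x = 0 then I ^ 2 - 1 / 2 else I ^ 2 - HH ζ x ^ 2 with hw
  have hH0 : ∀ x, 0 ≤ HH ζ x := fun x => by
    have := HH_mono hpos (Nat.zero_le x)
    rwa [HH_zero] at this
  have hH2 : HH ζ 2 = 1 := by
    have := HH_succ ζ (le_refl 1)
    rw [HH_one, ff_one] at this
    simpa using this
  have hI1 : 1 ≤ I := hH2 ▸ hI 2
  have hw0 : ∀ x, 0 ≤ w x := by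
    intro x
    simp only [hw]
    split_ifs
    · nlinarith
    · have := hI x
      have := hH0 x
      nlinarith
  set dl : ℕ → ℝ := fun x => if x < 2 then 1 / 2 else q x * ff ζ (x - 1) ^ 2 with hdl
  have hdl0 : ∀ x, 0 < dl x := by
    intro x
    simp only [hdl]
    split_ifs with hx
    · norm_num
    · have := h.hq x (by omega)
      have := ff_pos hpos (x - 1)
      positivity
  have hst : ∀ x, stepR q p1 p2 w x + dl x ≤ w x := by
    intro x
    rcases Nat.lt_or_ge x 2 with hx | hx
    · interval_cases x
      · simp [stepR, hw, hdl, hH2]; linarith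
      · simp [stepR, hw, hdl, HH_one]
    · rw [stepR_of_two_le _ _ _ _ hx]
      have e : dl x = q x * ff ζ (x - 1) ^ 2 := by
        simp only [hdl]; rw [if_neg (by omega)]
      have ew : ∀ y, 1 ≤ y → w y = I ^ 2 - HH ζ y ^ 2 := by
        intro y hy
        simp only [hw]; rw [if_neg (by omega)]
      rw [e, ew _ (by omega), ew _ (by omega), ew _ (by omega), ew _ (by omega)]
      have hh := harm_of_diff h (HH ζ) hx (HH_diff hrec hx)
      have hd := HH_succ ζ (by omega : 1 ≤ x - 1)
      rw [Nat.sub_add_cancel (by omega)] at hd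
      have hq := h.hq x hx
      have hp1 := h.hp1 x hx
      have hp2 := h.hp2 x hx
      have hs := h.hsum x hx
      have hf : ff ζ (x - 1) = HH ζ x - HH ζ (x - 1) := by linarith
      rw [hf]
      have t1 := mul_nonneg hp1 (sq_nonneg (HH ζ (x + 1) - HH ζ x))
      have t2 := mul_nonneg hp2.le (sq_nonneg (HH ζ (x + 2) - HH ζ x))
      have key : q x * HH ζ (x - 1) ^ 2 + p1 x * HH ζ (x + 1) ^ 2 + p2 x * HH ζ (x + 2) ^ 2
          - HH ζ x ^ 2 = q x * (HH ζ x - HH ζ (x - 1)) ^ 2 + p1 x * (HH ζ (x + 1) - HH ζ x) ^ 2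
            + p2 x * (HH ζ (x + 2) - HH ζ x) ^ 2 := by
        linear_combination (2 * HH ζ x) * hh - (HH ζ x ^ 2) * hs
      have key2 : q x * I ^ 2 + p1 x * I ^ 2 + p2 x * I ^ 2 = I ^ 2 := by
        linear_combination I ^ 2 * hs
      nlinarith
  obtain ⟨x0, -, hx0⟩ := Finset.exists_min_image (Finset.range (K + 1)) dl ⟨0, by simp⟩
  refine transient_of_super hμ (fun x => ENNReal.ofReal (w x)) ENNReal.ofReal_ne_top K
    (ENNReal.ofReal (dl x0)) (by simpa using hdl0 x0) ENNReal.ofReal_ne_top ?_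
  intro x
  rw [stepE_ofReal h w hw0]
  have h1 := hst x
  split_ifs with hx
  · rcases le_or_gt 0 (stepR q p1 p2 w x) with h2 | h2
    · rw [← ENNReal.ofReal_add h2 (hdl0 x0).le]
      apply ENNReal.ofReal_le_ofReal
      have := hx0 x (Finset.mem_range.2 (by omega))
      linarith
    · exfalso
      have : 0 ≤ stepR q p1 p2 w x := by
        unfold stepR
        split_ifs
        · exact hw0 _
        · exact hw0 _
        · have := h.hq x (by omega)
          have := h.hp1 x (by omega)
          have := h.hp2 x (by omega)
          have := hw0 (x - 1)
          have := hw0 (x + 1)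
          have := hw0 (x + 2)
          positivity
      linarith
  · rw [add_zero]
    apply ENNReal.ofReal_le_ofReal
    linarith [hdl0 x]

/-- Escape probability from `n+1` without hitting `n`. -/
def esc (ζ : ℕ → ℝ) (I : ℝ) (n : ℕ) : ℝ := ff ζ n / (I - HH ζ n)

lemma esc_pos {ζ : ℕ → ℝ} (hpos : ∀ k, 2 ≤ k → 0 < ζ k) {I : ℝ} (hI : ∀ x, HH ζ x < I) (n : ℕ) :
    0 < esc ζ I n := div_pos (ff_pos hpos n) (by linarith [hI n])

lemma esc_le_one {ζ : ℕ → ℝ} {I : ℝ} (hI : ∀ x, HH ζ x < I) {n : ℕ} (hn : 1 ≤ n) :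
    esc ζ I n ≤ 1 := by
  unfold esc
  rw [div_le_one (by linarith [hI n])]
  have := HH_succ ζ hn
  linarith [hI (n + 1)]

lemma cut_lower (h : WalkHyp q p1 p2) {ζ : ℕ → ℝ} (hpos : ∀ k, 2 ≤ k → 0 < ζ k)
    (hrec : ∀ k, 2 ≤ k → ζ k * ((p1 k + p2 k) / q k + p2 k / q k * ζ (k + 1)) = 1)
    {μ : Measure (ℕ → ℕ)} [IsProbabilityMeasure μ]
    (hμ : IsMarkovChain μ (transY q p1 p2) 2) {I : ℝ} (hI : ∀ x, HH ζ x < I)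
    {n : ℕ} (hn : 3 ≤ n) :
    ENNReal.ofReal (tau q p1 p2 2 n * esc ζ I n) ≤ μ {ω | ∀ t, ω t ≠ n} := by
  set e := esc ζ I n with he
  have he0 : 0 < e := esc_pos hpos hI n
  have he1 : e ≤ 1 := esc_le_one hI (by omega)
  have hIn : 0 < I - HH ζ n := by linarith [hI n]
  set g : ℕ → ℝ := fun x => if x ≤ n then tau q p1 p2 x n * e else (HH ζ x - HH ζ n) / (I - HH ζ n)
    with hg
  have g1 : ∀ x, x ≤ n + 1 → g x = tau q p1 p2 x n * e := by
    intro x hx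
    simp only [hg]
    split_ifs with hxn
    · rfl
    · obtain rfl : x = n + 1 := by omega
      rw [tau_succ_self h (by omega), HH_succ ζ (by omega), he, esc]
      ring
  have g2 : ∀ x, n ≤ x → g x = (HH ζ x - HH ζ n) / (I - HH ζ n) := by
    intro x hx
    simp only [hg]
    split_ifs with hxn
    · obtain rfl : x = n := by omega
      rw [tau_self]; simp
    · rfl
  have hg0 : ∀ x, 0 ≤ g x := by
    intro x
    rcases le_total x n with hx | hx
    · rw [g1 x (by omega)]
      exact mul_nonneg (tau_bounds h n (by omega) x hx).1 he0.le
    · rw [g2 x hx]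
      exact div_nonneg (by linarith [HH_mono hpos hx]) hIn.le
  have hgle : ∀ x, g x ≤ 1 := by
    intro x
    rcases le_total x n with hx | hx
    · rw [g1 x (by omega)]
      have := tau_bounds h n (by omega) x hx
      nlinarith
    · rw [g2 x hx, div_le_one hIn]
      linarith [hI x]
  have hgn : g n = 0 := by rw [g1 n (by omega), tau_self, zero_mul]
  have hst : ∀ x, x ≠ n → stepR q p1 p2 g x = g x := by
    intro x hx
    rcases Nat.lt_or_ge x n with h1 | h1
    · rcases Nat.lt_or_ge x 2 with h2 | h2
      · have hs : ∀ y ≤ 2, g y = tau q p1 p2 2 n * e := by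
          intro y hy
          rw [g1 y (by omega)]
          simp [tau, KK_small hy, KK_small le_rfl]
        unfold stepR
        interval_cases x
        · simp [hs]
        · simp [hs]
      · refine harm_comb h hrec 0 (e / DD q p1 p2 n) (-(KK q p1 p2 n * e / DD q p1 p2 n)) g h2 ?_
        intro y _ hy
        rw [g1 y (by omega), tau]
        ring
    · refine harm_comb h hrec (1 / (I - HH ζ n)) 0 (-(HH ζ n / (I - HH ζ n))) g (by omega) ?_
      intro y hy _
      rw [g2 y (by omega)]
      ring
  have := prob_avoid_ge hμ {n} (by simp; omega) (fun x => ENNReal.ofReal (g x))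
    (fun x => by simpa using hgle x) (fun x hx => by
      obtain rfl : x = n := hx
      simp [hgn]) (fun x hx => by
      rw [stepE_ofReal h g hg0, hst x (by simpa using hx)])
  rw [g1 2 (by omega)] at this
  simpa using this

lemma double_null (h : WalkHyp q p1 p2) {ζ : ℕ → ℝ} (hpos : ∀ k, 2 ≤ k → 0 < ζ k)
    (hrec : ∀ k, 2 ≤ k → ζ k * ((p1 k + p2 k) / q k + p2 k / q k * ζ (k + 1)) = 1)
    {μ : Measure (ℕ → ℕ)} [IsProbabilityMeasure μ]
    (hμ : IsMarkovChain μ (transY q p1 p2) 2) {I : ℝ} (hI : ∀ x, HH ζ x < I)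
    {n : ℕ} (hn : 3 ≤ n) : μ {ω | ∀ t, ω t ∉ ({n, n + 1} : Set ℕ)} = 0 := by
  set g : ℕ → ℝ := fun x => if x ≤ n + 1 then 0 else 1 with hg
  have hg0 : ∀ x, 0 ≤ g x := by intro x; simp only [hg]; split_ifs <;> norm_num
  have hg1 : ∀ x, g x ≤ 1 := by intro x; simp only [hg]; split_ifs <;> norm_num
  have hgs : ∀ x, x ≤ n + 1 → g x = 0 := by intro x hx; simp only [hg]; rw [if_pos hx]
  have hst : ∀ x, x ∉ ({n, n + 1} : Set ℕ) → stepR q p1 p2 g x ≤ g x := by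
    intro x hx
    simp only [Set.mem_insert_iff, Set.mem_singleton_iff, not_or] at hx
    rcases Nat.lt_or_ge x n with h1 | h1
    · unfold stepR
      rw [hgs 2 (by omega), hgs 0 (by omega), hgs (x - 1) (by omega), hgs (x + 1) (by omega),
        hgs (x + 2) (by omega), hgs x (by omega)]
      simp
    · rw [stepR_of_two_le _ _ _ _ (by omega)]
      have : g x = 1 := by simp only [hg]; rw [if_neg (by omega)]
      rw [this]
      have hq := h.hq x (by omega)
      have hp1 := h.hp1 x (by omega)
      have hp2 := h.hp2 x (by omega)
      have hs := h.hsum x (by omega)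
      have t1 := mul_le_mul_of_nonneg_left (hg1 (x - 1)) hq.le
      have t2 := mul_le_mul_of_nonneg_left (hg1 (x + 1)) hp1
      have t3 := mul_le_mul_of_nonneg_left (hg1 (x + 2)) hp2.le
      linarith
  have := prob_avoid_le hμ {n, n + 1} (by simp; omega) (fun x => ENNReal.ofReal (g x))
    (fun x hx => by
      rw [stepE_ofReal h g hg0]
      exact ENNReal.ofReal_le_ofReal (hst x hx))
    (walk_transient h hpos hrec hμ (fun x => (hI x).le)) (by
      refine tendsto_const_nhds.congr' ?_
      filter_upwards [eventually_ge_atTop (n + 2)] with x hx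
      simp only [hg]
      rw [if_neg (by omega)]
      simp)
  rw [hgs 2 (by omega)] at this
  simpa using this

lemma den_eq (h : WalkHyp q p1 p2) (ζ : ℕ → ℝ) (n l : ℕ) (hl : 2 ≤ l) :
    DD q p1 p2 l * (HH ζ l - HH ζ n) - ff ζ l * (KK q p1 p2 l - KK q p1 p2 n)
      = DD q p1 p2 l * ((HH ζ l - HH ζ n) + ff ζ l * tau q p1 p2 n l) := by
  unfold tau
  have := DD_ne h l hl
  field_simp
  ring

/-- Probability, from `n+1`, of jumping over `l` before hitting `n`. -/
def sprob (q p1 p2 ζ : ℕ → ℝ) (n l : ℕ) : ℝ :=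
  (ff ζ n * tau q p1 p2 n l + (HH ζ l - HH ζ n) * (DD q p1 p2 n / DD q p1 p2 l))
    / ((HH ζ l - HH ζ n) + ff ζ l * tau q p1 p2 n l)

lemma joint_upper (h : WalkHyp q p1 p2) {ζ : ℕ → ℝ} (hpos : ∀ k, 2 ≤ k → 0 < ζ k)
    (hrec : ∀ k, 2 ≤ k → ζ k * ((p1 k + p2 k) / q k + p2 k / q k * ζ (k + 1)) = 1)
    {μ : Measure (ℕ → ℕ)} [IsProbabilityMeasure μ]
    (hμ : IsMarkovChain μ (transY q p1 p2) 2) {I : ℝ} (hI : ∀ x, HH ζ x < I)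
    (hlim : Tendsto (HH ζ) atTop (𝓝 I))
    {n l : ℕ} (hn : 3 ≤ n) (hnl : n + 2 ≤ l) :
    0 ≤ sprob q p1 p2 ζ n l ∧ μ {ω | ∀ t, ω t ∉ ({n, l} : Set ℕ)}
      ≤ ENNReal.ofReal (tau q p1 p2 2 n * sprob q p1 p2 ζ n l * esc ζ I l) := by
  set e := esc ζ I l with he
  have he0 : 0 < e := esc_pos hpos hI l
  have hIl : 0 < I - HH ζ l := by linarith [hI l]
  have hDl := DD_ne h l (by omega)
  have htau := (tau_bounds h l (by omega) n (by omega)).1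
  have hF : 0 < HH ζ l - HH ζ n := by linarith [HH_lt hpos (by omega : 1 ≤ n) (by omega : n < l)]
  have hfl := ff_pos hpos l
  set W := (HH ζ l - HH ζ n) + ff ζ l * tau q p1 p2 n l with hW
  have hW0 : 0 < W := by positivity
  -- the harmonic function in the middle region
  set A := tau q p1 p2 n l / W with hA
  set B := (HH ζ l - HH ζ n) / (DD q p1 p2 l * W) with hB
  set u : ℕ → ℝ := fun x => A * (HH ζ x - HH ζ n) + B * (KK q p1 p2 x - KK q p1 p2 n) with hu
  have htl : KK q p1 p2 n - KK q p1 p2 l = tau q p1 p2 n l * DD q p1 p2 l := by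
    unfold tau; field_simp
  have un : u n = 0 := by simp [hu]
  have ul : u l = 0 := by
    simp only [hu, hA, hB]
    have : KK q p1 p2 l - KK q p1 p2 n = -(tau q p1 p2 n l * DD q p1 p2 l) := by linarith
    rw [this]
    field_simp
    ring
  have ul1 : u (l + 1) = 1 := by
    have : u (l + 1) = u l + A * ff ζ l + B * DD q p1 p2 l := by
      simp only [hu]
      rw [HH_succ ζ (by omega), KK_succ]; ring
    rw [this, ul, hA, hB]
    field_simp
    rw [hW]; ring
  have un1 : u (n + 1) = sprob q p1 p2 ζ n l := by
    simp only [hu, sprob]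
    rw [HH_succ ζ (by omega), KK_succ, ← hW, hA, hB]
    field_simp
    ring
  have hucomb : ∀ y, u y = A * HH ζ y + B * KK q p1 p2 y + (-(A * HH ζ n) - B * KK q p1 p2 n) := by
    intro y; simp only [hu]; ring
  have huh : ∀ x, 2 ≤ x → stepR q p1 p2 u x = u x := fun x hx =>
    harm_comb h hrec A B _ u hx (fun y _ _ => hucomb y)
  have hunn := min_principle h u (by omega : 1 ≤ n) (by omega : n ≤ l)
    (fun x hx _ => by
      have := huh x (by omega)
      rwa [stepR_of_two_le _ _ _ _ (by omega)] at this) un.ge ul.ge (by rw [ul1]; norm_num)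
  have hs0 : 0 ≤ sprob q p1 p2 ζ n l := by
    rw [← un1]; exact hunn _ (by omega) (by omega)
  refine ⟨hs0, ?_⟩
  set s := sprob q p1 p2 ζ n l with hs
  set g : ℕ → ℝ := fun x => if x ≤ n then tau q p1 p2 x n * s * e else
    if x ≤ l then u x * e else (HH ζ x - HH ζ l) / (I - HH ζ l) with hg
  have g1 : ∀ x, x ≤ n + 1 → g x = tau q p1 p2 x n * s * e := by
    intro x hx
    simp only [hg]
    split_ifs with h1 h2
    · rfl
    · obtain rfl : x = n + 1 := by omega
      rw [tau_succ_self h (by omega), un1, one_mul]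
    · omega
  have g2 : ∀ x, n ≤ x → x ≤ l + 1 → g x = u x * e := by
    intro x hx hx2
    simp only [hg]
    split_ifs with h1 h2
    · obtain rfl : x = n := by omega
      rw [tau_self, un]; simp
    · rfl
    · obtain rfl : x = l + 1 := by omega
      rw [ul1, HH_succ ζ (by omega), he, esc]
      ring
  have g3 : ∀ x, l ≤ x → g x = (HH ζ x - HH ζ l) / (I - HH ζ l) := by
    intro x hx
    rcases hx.eq_or_lt with rfl | hx
    · rw [g2 l (by omega) (by omega), ul]; simp
    · simp only [hg]
      rw [if_neg (by omega), if_neg (by omega)]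
  have hg0 : ∀ x, 0 ≤ g x := by
    intro x
    rcases le_total x n with hx | hx
    · rw [g1 x (by omega)]
      exact mul_nonneg (mul_nonneg (tau_bounds h n (by omega) x hx).1 hs0) he0.le
    · rcases le_total x l with hx2 | hx2
      · rw [g2 x hx (by omega)]
        exact mul_nonneg (hunn x hx (by omega)) he0.le
      · rw [g3 x hx2]
        exact div_nonneg (by linarith [HH_mono hpos hx2]) hIl.le
  have hst : ∀ x, x ∉ ({n, l} : Set ℕ) → stepR q p1 p2 g x = g x := by
    intro x hx
    simp only [Set.mem_insert_iff, Set.mem_singleton_iff, not_or] at hx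
    rcases Nat.lt_or_ge x n with h1 | h1
    · rcases Nat.lt_or_ge x 2 with h2 | h2
      · have hs : ∀ y ≤ 2, g y = tau q p1 p2 2 n * s * e := by
          intro y hy
          rw [g1 y (by omega)]
          simp [tau, KK_small hy, KK_small le_rfl]
        unfold stepR
        interval_cases x
        · simp [hs]
        · simp [hs]
      · refine harm_comb h hrec 0 (s * e / DD q p1 p2 n)
          (-(KK q p1 p2 n * s * e / DD q p1 p2 n)) g h2 ?_
        intro y _ hy
        rw [g1 y (by omega), tau]
        ring
    · rcases Nat.lt_or_ge x l with h2 | h2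
      · refine harm_comb h hrec (A * e) (B * e) ((-(A * HH ζ n) - B * KK q p1 p2 n) * e) g
          (by omega) ?_
        intro y hy hy2
        rw [g2 y (by omega) (by omega), hucomb]
        ring
      · refine harm_comb h hrec (1 / (I - HH ζ l)) 0 (-(HH ζ l / (I - HH ζ l))) g (by omega) ?_
        intro y hy _
        rw [g3 y (by omega)]
        ring
  have := prob_avoid_le hμ {n, l} (by simp; omega) (fun x => ENNReal.ofReal (g x))
    (fun x hx => by rw [stepE_ofReal h g hg0, hst x hx])
    (walk_transient h hpos hrec hμ (fun x => (hI x).le)) (by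
      rw [← ENNReal.ofReal_one]
      refine ENNReal.tendsto_ofReal ?_
      have h1 : Tendsto (fun x => (HH ζ x - HH ζ l) / (I - HH ζ l)) atTop
          (𝓝 ((I - HH ζ l) / (I - HH ζ l))) := (hlim.sub_const _).div_const _
      rw [div_self hIl.ne'] at h1
      refine h1.congr' ?_
      filter_upwards [eventually_ge_atTop l] with x hx
      exact (g3 x hx).symm)
  rwa [g1 2 (by omega)] at this

end prob

section asym
variable {q p1 p2 : ℕ → ℝ}

lemma SS_tendsto (h : WalkHyp q p1 p2) {a b : ℝ} (ha : 0 < a) (hb : 0 < b)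
    (hCa : Tendsto (fun k => (p1 k + p2 k) / q k) atTop (𝓝 a))
    (hCb : Tendsto (fun k => p2 k / q k) atTop (𝓝 b)) (hab : a + b = 1) :
    Tendsto (SS q p1 p2) atTop (𝓝 b) := by
  have e2 := eventually_ge_atTop 2
  obtain ⟨l, hl0, hl, ht⟩ := core_tendsto (z := SS q p1 p2) (γ := fun _ => 1) (g := 1) (C := 1)
    1 0 (fun k => rfl) (fun k => rfl)
    (by filter_upwards [e2] with k hk using (SS_bounds h k hk).1)
    (by filter_upwards [e2] with k hk using (SS_bounds h k hk).2)
    zero_le_one (Eventually.of_forall fun _ => zero_le_one) hCa tendsto_const_nhds hCb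
    (by filter_upwards [e2] with k hk using SS_rec h hk) ha
  have : (l - b) * (l + 1) = 0 := by
    have : a = 1 - b := by linarith
    subst this
    linear_combination hl
  rcases mul_eq_zero.1 this with h1 | h1
  · have : l = b := by linarith
    rwa [this] at ht
  · linarith

lemma zeta_tendsto (h : WalkHyp q p1 p2) {ζ : ℕ → ℝ} (hpos : ∀ k, 2 ≤ k → 0 < ζ k)
    (hrec : ∀ k, 2 ≤ k → ζ k * ((p1 k + p2 k) / q k + p2 k / q k * ζ (k + 1)) = 1)
    {a b : ℝ} (ha : 0 < a) (hb : 0 < b)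
    (hCa : Tendsto (fun k => (p1 k + p2 k) / q k) atTop (𝓝 a))
    (hCb : Tendsto (fun k => p2 k / q k) atTop (𝓝 b)) (hab : a + b = 1) :
    Tendsto ζ atTop (𝓝 1) := by
  have e2 := eventually_ge_atTop 2
  obtain ⟨l, hl0, hl, ht⟩ := core_tendsto (z := ζ) (β := fun _ => 1) (c := 1) (C := 2 / a)
    0 1 (fun k => rfl) (fun k => rfl)
    (by filter_upwards [e2] with k hk using (hpos k hk).le)
    (by
      filter_upwards [e2, hCa.eventually (lt_mem_nhds (half_lt_self ha))] with k hk hk2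
      have h1 := hrec k hk
      have h2 := hpos k hk
      have h3 := hpos (k + 1) (by omega)
      have h4 := b_pos h hk
      rw [le_div_iff₀ ha]
      have h5 : 0 ≤ ζ k * (p2 k / q k * ζ (k + 1)) := by positivity
      have h6 := mul_lt_mul_of_pos_left hk2 h2
      nlinarith)
    hb.le (by filter_upwards [e2] with k hk using (b_pos h hk).le) hCa hCb tendsto_const_nhds
    (by filter_upwards [e2] with k hk using hrec k hk) ha
  have : (l - 1) * (b * l + 1) = 0 := by
    have : a = 1 - b := by linarith
    subst this
    linear_combination hl
  rcases mul_eq_zero.1 this with h1 | h1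
  · have : l = 1 := by linarith
    rwa [this] at ht
  · have : 0 ≤ b * l := by positivity
    linarith

lemma DD_ratio (h : WalkHyp q p1 p2) {β : ℝ} (hβ : 0 ≤ β) {k1 : ℕ}
    (hS : ∀ i, k1 ≤ i → SS q p1 p2 i ≤ β) {n : ℕ} (hn : k1 ≤ n) (hn2 : 2 ≤ n) (d : ℕ) :
    |DD q p1 p2 n| ≤ β ^ d * |DD q p1 p2 (n + d)| := by
  induction d with
  | zero => simp
  | succ d ih =>
    have h1 := DD_SS h (by omega : 1 ≤ n + d)
    have h2 : |DD q p1 p2 (n + d)| = |DD q p1 p2 (n + d + 1)| * SS q p1 p2 (n + d + 1) := by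
      rw [← abs_neg, ← h1, abs_mul, abs_of_nonneg (SS_bounds h _ (by omega)).1]
    rw [← add_assoc]
    calc |DD q p1 p2 n| ≤ β ^ d * |DD q p1 p2 (n + d)| := ih
      _ = β ^ d * (|DD q p1 p2 (n + d + 1)| * SS q p1 p2 (n + d + 1)) := by rw [h2]
      _ ≤ β ^ d * (|DD q p1 p2 (n + d + 1)| * β) := by
        gcongr
        exact hS _ (by omega)
      _ = _ := by ring

lemma ff_growth {ζ : ℕ → ℝ} (hpos : ∀ k, 2 ≤ k → 0 < ζ k) {z : ℝ} (hz : 1 ≤ z) {k1 : ℕ}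
    (hS : ∀ i, k1 ≤ i → ζ i ≤ z) {n : ℕ} (hn : k1 ≤ n) (hn2 : 2 ≤ n) (d : ℕ) :
    ff ζ (n + d) ≤ ff ζ n * z ^ d ∧ HH ζ (n + d) - HH ζ n ≤ ff ζ n * (d * z ^ d) := by
  have hfn := ff_pos hpos n
  induction d with
  | zero => simp
  | succ d ih =>
    have h1 : ff ζ (n + d + 1) ≤ ff ζ n * z ^ (d + 1) := by
      rw [ff_succ ζ (by omega)]
      calc ff ζ (n + d) * ζ (n + d + 1) ≤ (ff ζ n * z ^ d) * z := by
            gcongr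
            · exact (hpos _ (by omega)).le
            · exact ih.1
            · exact hS _ (by omega)
        _ = _ := by ring
    refine ⟨h1, ?_⟩
    rw [← add_assoc, HH_succ ζ (by omega)]
    have h2 : z ^ d ≤ z ^ (d + 1) := pow_le_pow_right₀ hz (by omega)
    have h3 : ff ζ n * (d * z ^ d) ≤ ff ζ n * (d * z ^ (d + 1)) := by gcongr
    have h4 : ff ζ n * z ^ d ≤ ff ζ n * z ^ (d + 1) := by gcongr
    push_cast
    nlinarith [ih.1, ih.2]

lemma sprob_bound (h : WalkHyp q p1 p2) {ζ : ℕ → ℝ} (hpos : ∀ k, 2 ≤ k → 0 < ζ k)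
    {n l : ℕ} (hn : 3 ≤ n) (hnl : n < l) :
    sprob q p1 p2 ζ n l * (HH ζ l - HH ζ n) ≤ ff ζ n * tau q p1 p2 2 l
      + (ff ζ n + (HH ζ l - HH ζ n)) * |DD q p1 p2 n / DD q p1 p2 l| := by
  have htau := (tau_bounds h l (by omega) n (by omega)).1
  have hF : 0 < HH ζ l - HH ζ n := by linarith [HH_lt hpos (by omega : 1 ≤ n) hnl]
  have hfl := ff_pos hpos l
  have hfn := ff_pos hpos n
  have hDl := DD_ne h l (by omega)
  have hDn := DD_ne h n (by omega)
  have e : tau q p1 p2 n l = tau q p1 p2 2 l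
      - tau q p1 p2 2 n * (DD q p1 p2 n / DD q p1 p2 l) := by
    unfold tau
    rw [KK_small le_rfl]
    field_simp
    ring
  set ρ := DD q p1 p2 n / DD q p1 p2 l with hρ
  have ht : tau q p1 p2 n l ≤ tau q p1 p2 2 l + |ρ| := by
    rw [e]
    have h1 := tau_bounds h n (by omega) 2 (by omega)
    have h2 : -(tau q p1 p2 2 n * ρ) ≤ |ρ| := by
      calc -(tau q p1 p2 2 n * ρ) ≤ |tau q p1 p2 2 n * ρ| := neg_le_abs _
        _ = tau q p1 p2 2 n * |ρ| := by rw [abs_mul, abs_of_nonneg h1.1]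
        _ ≤ 1 * |ρ| := by gcongr; exact h1.2
        _ = |ρ| := one_mul _
    linarith
  set F := HH ζ l - HH ζ n with hFd
  have step1 : sprob q p1 p2 ζ n l * F ≤ ff ζ n * tau q p1 p2 n l + F * |ρ| := by
    unfold sprob
    rw [← hρ, ← hFd]
    set X := ff ζ n * tau q p1 p2 n l + F * |ρ| with hX
    have hX0 : 0 ≤ X := by positivity
    have hle : ff ζ n * tau q p1 p2 n l + F * ρ ≤ X := by
      rw [hX]; gcongr; exact le_abs_self _
    have hW : 0 < F + ff ζ l * tau q p1 p2 n l := by positivity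
    rw [div_mul_eq_mul_div, div_le_iff₀ hW]
    calc (ff ζ n * tau q p1 p2 n l + F * ρ) * F ≤ X * F := by gcongr
      _ ≤ X * (F + ff ζ l * tau q p1 p2 n l) := by
        gcongr
        have : 0 ≤ ff ζ l * tau q p1 p2 n l := by positivity
        linarith
  have step2 := mul_le_mul_of_nonneg_left ht hfn.le
  linarith

lemma sprob_asym (h : WalkHyp q p1 p2) {ζ : ℕ → ℝ} (hpos : ∀ k, 2 ≤ k → 0 < ζ k)
    (hrec : ∀ k, 2 ≤ k → ζ k * ((p1 k + p2 k) / q k + p2 k / q k * ζ (k + 1)) = 1)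
    {a b : ℝ} (ha : 0 < a) (hb : 0 < b)
    (hCa : Tendsto (fun k => (p1 k + p2 k) / q k) atTop (𝓝 a))
    (hCb : Tendsto (fun k => p2 k / q k) atTop (𝓝 b)) (hab : a + b = 1)
    {ε : ℝ} (hε : 0 < ε) :
    ∃ N k0 : ℕ, ∀ n l, 3 ≤ n → k0 ≤ n → n < l → n + N ≤ l →
      sprob q p1 p2 ζ n l * (HH ζ l - HH ζ n) ≤ (1 + ε) * tau q p1 p2 2 l * ff ζ n := by
  have hS := SS_tendsto h ha hb hCa hCb hab
  have hZ := zeta_tendsto h hpos hrec ha hb hCa hCb hab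
  have hb1 : b < 1 := by linarith
  set β := (b + 1) / 2 with hβ
  have hβ1 : β < 1 := by rw [hβ]; linarith
  have hbβ : b < β := by rw [hβ]; linarith
  have hβ0 : 0 < β := by linarith
  set r := (1 + β) / 2 with hr
  have hr1 : r < 1 := by rw [hr]; linarith
  have hβr : β < r := by rw [hr]; linarith
  set z := r / β with hz
  have hz1 : 1 < z := by rw [hz, one_lt_div hβ0]; exact hβr
  have hzβ : z * β = r := by rw [hz]; field_simp
  set c := b * (1 - b) / 2 with hc
  have hbb : 0 < b * (1 - b) := mul_pos hb (by linarith)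
  have hc0 : 0 < c := by rw [hc]; linarith
  obtain ⟨k1, hk1⟩ := eventually_atTop.1 (hS.eventually (gt_mem_nhds hbβ))
  obtain ⟨k2, hk2⟩ := eventually_atTop.1 (hZ.eventually (gt_mem_nhds hz1))
  have hT : Tendsto (fun k => SS q p1 p2 (k + 1) * (1 - SS q p1 p2 k)) atTop
      (𝓝 (b * (1 - b))) :=
    ((tendsto_add_atTop_iff_nat 1).2 hS).mul (tendsto_const_nhds.sub hS)
  obtain ⟨k3, hk3⟩ := eventually_atTop.1 (hT.eventually (lt_mem_nhds (by rw [hc]; linarith :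
    c < b * (1 - b))))
  have hd : Tendsto (fun d : ℕ => r ^ d + d * r ^ d) atTop (𝓝 (0 + 0)) :=
    (tendsto_pow_atTop_nhds_zero_of_lt_one (by linarith) hr1).add
      (tendsto_self_mul_const_pow_of_lt_one (by linarith) hr1)
  rw [add_zero] at hd
  obtain ⟨N, hN⟩ := eventually_atTop.1 (hd.eventually (gt_mem_nhds (mul_pos hε hc0)))
  refine ⟨N, k1 + k2 + k3 + 1, fun n l hn hk hnl hNl => ?_⟩
  refine (sprob_bound h hpos hn hnl).trans ?_
  obtain ⟨d, rfl⟩ : ∃ d, l = n + d := ⟨l - n, by omega⟩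
  have hfn := ff_pos hpos n
  have hDl := DD_ne h (n + d) (by omega)
  have hρ : |DD q p1 p2 n / DD q p1 p2 (n + d)| ≤ β ^ d := by
    rw [abs_div, div_le_iff₀ (abs_pos.2 hDl)]
    exact DD_ratio h hβ0.le (fun i hi => (hk1 i hi).le) (by omega) (by omega) d
  have hF := (ff_growth hpos hz1.le (fun i hi => (hk2 i hi).le) (by omega : k2 ≤ n)
    (by omega) d).2
  have hF0 : 0 ≤ HH ζ (n + d) - HH ζ n := by linarith [HH_mono hpos (by omega : n ≤ n + d)]
  have hTl : c ≤ tau q p1 p2 2 (n + d) := by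
    obtain ⟨y, hy⟩ : ∃ y, n + d = y + 2 := ⟨n + d - 2, by omega⟩
    rw [hy, tau_rec h 2 (by omega : 2 ≤ y + 1)]
    have h1 := hk3 (y + 1) (by omega)
    have h2 := tau_le_SS h (by omega : 2 ≤ y) (by omega : 2 ≤ y)
    have h3 := (SS_bounds h (y + 1 + 1) (by omega)).1
    refine h1.le.trans ?_
    gcongr
  have e1 : (ff ζ n + (HH ζ (n + d) - HH ζ n)) * |DD q p1 p2 n / DD q p1 p2 (n + d)|
      ≤ ff ζ n * (r ^ d + d * r ^ d) := by
    calc (ff ζ n + (HH ζ (n + d) - HH ζ n)) * |DD q p1 p2 n / DD q p1 p2 (n + d)|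
        ≤ (ff ζ n + ff ζ n * (d * z ^ d)) * β ^ d := by gcongr
      _ = ff ζ n * (β ^ d + d * (z * β) ^ d) := by rw [mul_pow]; ring
      _ ≤ ff ζ n * (r ^ d + d * r ^ d) := by
        rw [hzβ]; gcongr
  have e2 : ff ζ n * (r ^ d + d * r ^ d) ≤ ff ζ n * (ε * tau q p1 p2 2 (n + d)) := by
    gcongr
    refine (hN d (by omega)).le.trans ?_
    gcongr
  linarith

end asym

lemma measurableSet_never (n : ℕ) : MeasurableSet {ω : ℕ → ℕ | ∀ t, ω t ≠ n} := by
  have := avoid_iInter {n}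
  simp only [Set.mem_singleton_iff] at this
  have h2 : {ω : ℕ → ℕ | ∀ t, ω t ≠ n} = ⋂ t, avoid {n} t := this
  rw [h2]
  exact MeasurableSet.iInter fun t => measurableSet_avoid _ t

section final
variable {q p1 p2 : ℕ → ℝ}

lemma layer_lower (h : WalkHyp q p1 p2) {ζ : ℕ → ℝ} (hpos : ∀ k, 2 ≤ k → 0 < ζ k)
    (hrec : ∀ k, 2 ≤ k → ζ k * ((p1 k + p2 k) / q k + p2 k / q k * ζ (k + 1)) = 1)
    {μ : Measure (ℕ → ℕ)} [IsProbabilityMeasure μ]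
    (hμ : IsMarkovChain μ (transY q p1 p2) 2) {I : ℝ} (hI : ∀ x, HH ζ x < I)
    {n : ℕ} (hn : 3 ≤ n) :
    ENNReal.ofReal (tau q p1 p2 2 n * esc ζ I n + tau q p1 p2 2 (n + 1) * esc ζ I (n + 1))
      ≤ μ {ω | (∀ t, ω t ≠ n) ∨ (∀ t, ω t ≠ n + 1)} := by
  have e1 := esc_pos hpos hI n
  have e2 := esc_pos hpos hI (n + 1)
  have t1 := (tau_bounds h n (by omega) 2 (by omega)).1
  have t2 := (tau_bounds h (n + 1) (by omega) 2 (by omega)).1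
  rw [ENNReal.ofReal_add (by positivity) (by positivity)]
  refine (add_le_add (cut_lower h hpos hrec hμ hI hn)
    (cut_lower h hpos hrec hμ hI (by omega : 3 ≤ n + 1))).trans ?_
  rw [← measure_union_add_inter _ (measurableSet_never (n + 1))]
  have h0 := double_null h hpos hrec hμ hI hn
  have hsub : {ω : ℕ → ℕ | ∀ t, ω t ≠ n} ∩ {ω | ∀ t, ω t ≠ n + 1}
      ⊆ {ω | ∀ t, ω t ∉ ({n, n + 1} : Set ℕ)} := by
    rintro ω ⟨h1, h2⟩ t ht
    rcases ht with ht | ht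
    · exact h1 t ht
    · exact h2 t ht
  rw [measure_mono_null hsub h0, add_zero]
  exact le_of_eq rfl

lemma joint_bound (h : WalkHyp q p1 p2) {ζ : ℕ → ℝ} (hpos : ∀ k, 2 ≤ k → 0 < ζ k)
    (hrec : ∀ k, 2 ≤ k → ζ k * ((p1 k + p2 k) / q k + p2 k / q k * ζ (k + 1)) = 1)
    {μ : Measure (ℕ → ℕ)} [IsProbabilityMeasure μ]
    (hμ : IsMarkovChain μ (transY q p1 p2) 2) {I : ℝ} (hI : ∀ x, HH ζ x < I)
    (hlim : Tendsto (HH ζ) atTop (𝓝 I)) {ε : ℝ} (hε : 0 < ε)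
    {n l M K : ℕ} (hn : 3 ≤ n) (hnM : n ≤ M) (hMK : M < K) (hKl : K ≤ l) (hnl : n + 2 ≤ l)
    (hs : sprob q p1 p2 ζ n l * (HH ζ l - HH ζ n) ≤ (1 + ε) * tau q p1 p2 2 l * ff ζ n) :
    μ ({ω | ∀ t, ω t ≠ n} ∩ {ω | ∀ t, ω t ≠ l}) ≤ ENNReal.ofReal ((1 + ε)
      * (tau q p1 p2 2 n * esc ζ I n) * (tau q p1 p2 2 l * esc ζ I l)
      * ((I - HH ζ M) / (HH ζ K - HH ζ M))) := by
  obtain ⟨hs0, hle⟩ := joint_upper h hpos hrec hμ hI hlim hn hnl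
  have hsub : {ω : ℕ → ℕ | ∀ t, ω t ≠ n} ∩ {ω | ∀ t, ω t ≠ l}
      ⊆ {ω | ∀ t, ω t ∉ ({n, l} : Set ℕ)} := by
    rintro ω ⟨h1, h2⟩ t ht
    rcases ht with ht | ht
    · exact h1 t ht
    · exact h2 t ht
  refine (measure_mono hsub).trans (hle.trans (ENNReal.ofReal_le_ofReal ?_))
  have e1 := esc_pos hpos hI n
  have e2 := esc_pos hpos hI l
  have t1 := (tau_bounds h n (by omega) 2 (by omega)).1
  have t2 := (tau_bounds h l (by omega) 2 (by omega)).1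
  have hln : HH ζ n < HH ζ l := HH_lt hpos (by omega) (by omega)
  have hKM : HH ζ M < HH ζ K := HH_lt hpos (by omega) hMK
  have hKl' : HH ζ K ≤ HH ζ l := HH_mono hpos hKl
  have hnM' : HH ζ n ≤ HH ζ M := HH_mono hpos hnM
  have hIl := hI l
  have key : sprob q p1 p2 ζ n l ≤ (1 + ε) * tau q p1 p2 2 l * esc ζ I n
      * ((I - HH ζ M) / (HH ζ K - HH ζ M)) := by
    have h1 : sprob q p1 p2 ζ n l ≤ (1 + ε) * tau q p1 p2 2 l * ff ζ n / (HH ζ l - HH ζ n) := by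
      rw [le_div_iff₀ (by linarith)]; exact hs
    refine h1.trans ?_
    have h2 : ff ζ n / (HH ζ l - HH ζ n)
        = esc ζ I n * ((I - HH ζ n) / (HH ζ l - HH ζ n)) := by
      unfold esc
      have : I - HH ζ n ≠ 0 := by linarith [hI n]
      field_simp
    have h3 : (I - HH ζ n) / (HH ζ l - HH ζ n) ≤ (I - HH ζ M) / (HH ζ K - HH ζ M) := by
      rw [div_le_div_iff₀ (by linarith) (by linarith)]
      nlinarith
    rw [mul_div_assoc, h2, ← mul_assoc]
    gcongr
  calc tau q p1 p2 2 n * sprob q p1 p2 ζ n l * esc ζ I l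
      ≤ tau q p1 p2 2 n * ((1 + ε) * tau q p1 p2 2 l * esc ζ I n
      * ((I - HH ζ M) / (HH ζ K - HH ζ M))) * esc ζ I l := by gcongr
    _ = _ := by ring

end final

lemma FYinf_lower {ζ : ℕ → ℝ} (hpos : ∀ k, 2 ≤ k → 0 < ζ k) {M : ℕ} (hM : 1 ≤ M) {n : ℕ}
    (hn : M + 1 ≤ n) :
    ENNReal.ofReal ((HH ζ n - HH ζ M) / ff ζ M) ≤ FYinf ζ M := by
  have h1 := ff_pos hpos M
  have h2 : (HH ζ n - HH ζ M) / ff ζ M = FYfin ζ M n := by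
    rw [← FYfin_mul ζ hM n hn]; field_simp
  rw [h2]
  exact le_iSup (fun n => ENNReal.ofReal (FYfin ζ M n)) n

lemma FYinf_top {ζ : ℕ → ℝ} (hpos : ∀ k, 2 ≤ k → 0 < ζ k) {M : ℕ} (hM : 1 ≤ M)
    (hB : ¬ BddAbove (Set.range (HH ζ))) : FYinf ζ M = ⊤ := by
  have h1 := ff_pos hpos M
  have ht : Tendsto (HH ζ) atTop atTop :=
    tendsto_atTop_atTop_of_monotone (HH_mono hpos) (by
      intro b
      by_contra hc
      push Not at hc
      exact hB ⟨b, by rintro _ ⟨x, rfl⟩; exact (hc x).le⟩)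
  have ht2 : Tendsto (fun n => ENNReal.ofReal ((HH ζ n - HH ζ M) / ff ζ M)) atTop (𝓝 ⊤) :=
    ENNReal.tendsto_ofReal_atTop.comp
      ((tendsto_atTop_add_const_right _ (-HH ζ M) ht).atTop_div_const h1)
  refine top_le_iff.mp (le_of_tendsto ht2 ?_)
  filter_upwards [eventually_ge_atTop (M + 1)] with n hn
  exact FYinf_lower hpos hM hn

theorem layer_cutpoint_correlation_bound
    (q p1 p2 : ℕ → ℝ)
    (hq : ∀ k, 2 ≤ k → 0 < q k) (hp1 : ∀ k, 2 ≤ k → 0 ≤ p1 k)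
    (hp2 : ∀ k, 2 ≤ k → 0 < p2 k)
    (hsum : ∀ k, 2 ≤ k → q k + p1 k + p2 k = 1)
    (μ : Measure (ℕ → ℕ)) [IsProbabilityMeasure μ]
    (hμ : IsMarkovChain μ (transY q p1 p2) 2)
    (a b : ℝ) (ha : 0 < a) (hb : 0 < b)
    (hCa : Tendsto (fun k => (p1 k + p2 k) / q k) atTop (𝓝 a))
    (hCb : Tendsto (fun k => p2 k / q k) atTop (𝓝 b))
    (hab : a + b = 1)
    (ζ : ℕ → ℝ)
    (hζ : ∀ k, 2 ≤ k →
      Tendsto (fun n => zetaApprox q p1 p2 k n) atTop (𝓝 (ζ k))) :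
    ∀ ε : ℝ, 0 < ε → ∃ N k₀ : ℕ, 0 < N ∧ 0 < k₀ ∧
      ∀ m k : ℕ, k₀ < m → m + N < k →
        μ {ω | ((∀ n, ω n ≠ 2 * m) ∨ (∀ n, ω n ≠ 2 * m + 1)) ∧
               ((∀ n, ω n ≠ 2 * k) ∨ (∀ n, ω n ≠ 2 * k + 1))}
          ≤ ENNReal.ofReal (1 + ε)
            * μ {ω | (∀ n, ω n ≠ 2 * m) ∨ (∀ n, ω n ≠ 2 * m + 1)}
            * μ {ω | (∀ n, ω n ≠ 2 * k) ∨ (∀ n, ω n ≠ 2 * k + 1)}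
            * FYinf ζ (2 * m + 1)
            / ENNReal.ofReal (FYfin ζ (2 * m + 1) (2 * k)) := by
  intro ε hε
  have h : WalkHyp q p1 p2 := ⟨hq, hp1, hp2, hsum⟩
  have hpos : ∀ k, 2 ≤ k → 0 < ζ k := fun k hk => zeta_pos h hζ hk
  have hrec : ∀ k, 2 ≤ k → ζ k * ((p1 k + p2 k) / q k + p2 k / q k * ζ (k + 1)) = 1 :=
    fun k hk => zeta_rec h hζ hk
  obtain ⟨N, k0, hs⟩ := sprob_asym h hpos hrec ha hb hCa hCb hab hε
  refine ⟨N + 1, k0 + 3, by omega, by omega, fun m k hm hk => ?_⟩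
  by_cases hB : BddAbove (Set.range (HH ζ))
  swap
  · rw [FYinf_top hpos (by omega) hB]
    by_cases z1 : μ {ω | (∀ n, ω n ≠ 2 * m) ∨ (∀ n, ω n ≠ 2 * m + 1)} = 0
    · refine le_trans (measure_mono fun ω hω => hω.1) (le_trans z1.le zero_le)
    by_cases z2 : μ {ω | (∀ n, ω n ≠ 2 * k) ∨ (∀ n, ω n ≠ 2 * k + 1)} = 0
    · refine le_trans (measure_mono fun ω hω => hω.2) (le_trans z2.le zero_le)
    have h3 : ENNReal.ofReal (1 + ε) ≠ 0 := by
      simp only [ne_eq, ENNReal.ofReal_eq_zero, not_le]; linarith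
    rw [ENNReal.mul_top (mul_ne_zero (mul_ne_zero h3 z1) z2),
      ENNReal.top_div_of_ne_top ENNReal.ofReal_ne_top]
    exact le_top
  have hlim : Tendsto (HH ζ) atTop (𝓝 (⨆ x, HH ζ x)) := tendsto_atTop_ciSup (HH_mono hpos) hB
  have hI : ∀ x, HH ζ x < ⨆ x, HH ζ x := fun x =>
    calc HH ζ x ≤ HH ζ (x + 1) := HH_mono hpos (by omega)
      _ < HH ζ (x + 2) := HH_lt hpos (by omega) (by omega)
      _ ≤ _ := le_ciSup hB _
  generalize (⨆ x, HH ζ x) = I at hlim hI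
  have hM := ff_pos hpos (2 * m + 1)
  have hMK : HH ζ (2 * m + 1) < HH ζ (2 * k) := HH_lt hpos (by omega) (by omega)
  have hIM := hI (2 * m + 1)
  have hF : FYfin ζ (2 * m + 1) (2 * k) = (HH ζ (2 * k) - HH ζ (2 * m + 1)) / ff ζ (2 * m + 1) := by
    rw [← FYfin_mul ζ (by omega) _ (by omega)]; field_simp
  have hFI : ENNReal.ofReal ((I - HH ζ (2 * m + 1)) / ff ζ (2 * m + 1)) ≤ FYinf ζ (2 * m + 1) := by
    refine le_of_tendsto (ENNReal.tendsto_ofReal ((hlim.sub_const _).div_const _)) ?_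
    filter_upwards [eventually_ge_atTop (2 * m + 1 + 1)] with n hn
    exact FYinf_lower hpos (by omega) hn
  have hc : ∀ n, 2 ≤ n → 0 ≤ tau q p1 p2 2 n * esc ζ I n := fun n hn =>
    mul_nonneg (tau_bounds h n hn 2 hn).1 (esc_pos hpos hI n).le
  have J : ∀ n l, 2 * m ≤ n → n ≤ 2 * m + 1 → 2 * k ≤ l → _ := fun n l h1 h2 h3 =>
    joint_bound h hpos hrec hμ hI hlim hε (n := n) (l := l) (M := 2 * m + 1) (K := 2 * k)
      (by omega) h2 (by omega) h3 (by omega) (hs n l (by omega) (by omega) (by omega) (by omega))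
  have L1 := layer_lower h hpos hrec hμ hI (n := 2 * m) (by omega)
  have L2 := layer_lower h hpos hrec hμ hI (n := 2 * k) (by omega)
  have c1 := hc (2 * m) (by omega)
  have c2 := hc (2 * m + 1) (by omega)
  have d1 := hc (2 * k) (by omega)
  have d2 := hc (2 * k + 1) (by omega)
  have J1 := J (2 * m) (2 * k) (by omega) (by omega) (by omega)
  have J2 := J (2 * m) (2 * k + 1) (by omega) (by omega) (by omega)
  have J3 := J (2 * m + 1) (2 * k) (by omega) (by omega) (by omega)
  have J4 := J (2 * m + 1) (2 * k + 1) (by omega) (by omega) (by omega)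
  clear J
  have hR : 0 ≤ (I - HH ζ (2 * m + 1)) / (HH ζ (2 * k) - HH ζ (2 * m + 1)) :=
    div_nonneg (by linarith) (by linarith)
  have hReq : (I - HH ζ (2 * m + 1)) / (HH ζ (2 * k) - HH ζ (2 * m + 1))
      = (I - HH ζ (2 * m + 1)) / ff ζ (2 * m + 1)
        / ((HH ζ (2 * k) - HH ζ (2 * m + 1)) / ff ζ (2 * m + 1)) := by
    have : HH ζ (2 * k) - HH ζ (2 * m + 1) ≠ 0 := by linarith
    field_simp
  have hT : 0 ≤ (I - HH ζ (2 * m + 1)) / ff ζ (2 * m + 1) := div_nonneg (by linarith) hM.le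
  have hB' : 0 < (HH ζ (2 * k) - HH ζ (2 * m + 1)) / ff ζ (2 * m + 1) :=
    div_pos (by linarith) hM
  rw [hF]
  generalize tau q p1 p2 2 (2 * m) * esc ζ I (2 * m) = C1 at *
  generalize tau q p1 p2 2 (2 * m + 1) * esc ζ I (2 * m + 1) = C2 at *
  generalize tau q p1 p2 2 (2 * k) * esc ζ I (2 * k) = D1 at *
  generalize tau q p1 p2 2 (2 * k + 1) * esc ζ I (2 * k + 1) = D2 at *
  generalize (I - HH ζ (2 * m + 1)) / (HH ζ (2 * k) - HH ζ (2 * m + 1)) = R at *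
  generalize (I - HH ζ (2 * m + 1)) / ff ζ (2 * m + 1) = T at *
  generalize (HH ζ (2 * k) - HH ζ (2 * m + 1)) / ff ζ (2 * m + 1) = B at *
  have e0 : 0 ≤ 1 + ε := by linarith
  have n1 : 0 ≤ (1 + ε) * C1 * D1 * R := by positivity
  have n2 : 0 ≤ (1 + ε) * C1 * D2 * R := by positivity
  have n3 : 0 ≤ (1 + ε) * C2 * D1 * R := by positivity
  have n4 : 0 ≤ (1 + ε) * C2 * D2 * R := by positivity
  calc _ ≤ μ (((({ω | ∀ t, ω t ≠ 2 * m} ∩ {ω | ∀ t, ω t ≠ 2 * k})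
          ∪ ({ω | ∀ t, ω t ≠ 2 * m} ∩ {ω | ∀ t, ω t ≠ 2 * k + 1}))
          ∪ ({ω | ∀ t, ω t ≠ 2 * m + 1} ∩ {ω | ∀ t, ω t ≠ 2 * k}))
          ∪ ({ω | ∀ t, ω t ≠ 2 * m + 1} ∩ {ω | ∀ t, ω t ≠ 2 * k + 1})) := by
        refine measure_mono ?_
        rintro ω ⟨h1 | h1, h2 | h2⟩
        · exact Or.inl (Or.inl (Or.inl ⟨h1, h2⟩))
        · exact Or.inl (Or.inl (Or.inr ⟨h1, h2⟩))
        · exact Or.inl (Or.inr ⟨h1, h2⟩)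
        · exact Or.inr ⟨h1, h2⟩
    _ ≤ ENNReal.ofReal ((1 + ε) * C1 * D1 * R) + ENNReal.ofReal ((1 + ε) * C1 * D2 * R)
        + ENNReal.ofReal ((1 + ε) * C2 * D1 * R) + ENNReal.ofReal ((1 + ε) * C2 * D2 * R) :=
        (measure_union_le _ _).trans (add_le_add ((measure_union_le _ _).trans
          (add_le_add ((measure_union_le _ _).trans (add_le_add J1 J2)) J3)) J4)
    _ = ENNReal.ofReal (((1 + ε) * (C1 + C2) * (D1 + D2) * T) / B) := by
        rw [← ENNReal.ofReal_add n1 n2, ← ENNReal.ofReal_add (by linarith) n3,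
          ← ENNReal.ofReal_add (by linarith) n4, hReq]
        congr 1
        ring
    _ = ENNReal.ofReal (1 + ε) * ENNReal.ofReal (C1 + C2) * ENNReal.ofReal (D1 + D2)
          * ENNReal.ofReal T / ENNReal.ofReal B := by
        rw [ENNReal.ofReal_div_of_pos hB', ENNReal.ofReal_mul' hT,
          ENNReal.ofReal_mul' (by linarith), ENNReal.ofReal_mul' (by linarith)]
    _ ≤ _ := by gcongr

end
end

section
/- Suppose Condition (C) holds and that ρ_k is monotone (either nondecreasing or nonincreasing) in k for k ≥ N₀, for some N₀. Then there exist constants 0 < c₅ < c₆ < ∞ such that for all integers m ≥ k ≥ 2, c₅ < (e₁ A_k A_{k+1}⋯A_m e₁ᵗ)/(ρ_k ρ_{k+1}⋯ρ_m) < c₆. -/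
open Filter Topology

noncomputable section

/-- The matrix `A_k` with first row `(a_k, b_k)` and second row `(1, 0)`. -/
def AmatG (a b : ℕ → ℝ) (k : ℕ) : Matrix (Fin 2) (Fin 2) ℝ :=
  !![a k, b k; 1, 0]

/-- The ordered product `A_s A_{s+1} ⋯ A_{n-1}` (identity when `s ≥ n`). -/
def prodAscG (a b : ℕ → ℝ) (s n : ℕ) : Matrix (Fin 2) (Fin 2) ℝ :=
  ((List.range (n - s)).map fun i => AmatG a b (s + i)).prod

/-- `ρ_k`, the spectral radius of `A_k`. -/
def rhoG (a b : ℕ → ℝ) (k : ℕ) : ℝ :=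
  (a k + Real.sqrt (a k ^ 2 + 4 * b k)) / 2

lemma log_bdd_aux (u : ℕ → ℝ) (l : ℝ) (hl : 0 < l) (h : Tendsto u atTop (𝓝 l)) :
    ∃ R : ℝ, 0 ≤ R ∧ ∀ k, |Real.log (u k)| ≤ R := by
  have h1 : Tendsto (fun k => |Real.log (u k)|) atTop (𝓝 |Real.log l|) :=
    (h.log hl.ne').abs
  obtain ⟨R, hR⟩ := h1.bddAbove_range
  have hR' : ∀ k, |Real.log (u k)| ≤ R := fun k => hR ⟨k, rfl⟩
  exact ⟨R, (abs_nonneg _).trans (hR' 0), hR'⟩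

lemma variation_aux (r : ℕ → ℝ) (R : ℝ) (hR : ∀ k, |r k| ≤ R) (N : ℕ)
    (h : (∀ k l, N ≤ k → k ≤ l → r k ≤ r l) ∨ (∀ k l, N ≤ k → k ≤ l → r l ≤ r k)) :
    Summable (fun j => |r (j + 1) - r j|) := by
  rw [← summable_nat_add_iff N]
  refine summable_of_sum_range_le (c := 2 * R) (fun _ => abs_nonneg _) ?_
  intro n
  have h1 := abs_le.1 (hR N)
  have h2 := abs_le.1 (hR (n + N))
  rcases h with h | h
  · have : ∀ i, |r (i + N + 1) - r (i + N)| = r (i + 1 + N) - r (i + N) := by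
      intro i
      rw [show i + 1 + N = i + N + 1 by omega]
      exact abs_of_nonneg (sub_nonneg.2 (h _ _ (by omega) (by omega)))
    simp only [this]
    rw [Finset.sum_range_sub (fun i => r (i + N))]
    simp only [zero_add]
    linarith
  · have : ∀ i, |r (i + N + 1) - r (i + N)| = r (i + N) - r (i + 1 + N) := by
      intro i
      rw [show i + 1 + N = i + N + 1 by omega, abs_sub_comm]
      exact abs_of_nonneg (sub_nonneg.2 (h _ _ (by omega) (by omega)))
    simp only [this]
    rw [Finset.sum_range_sub' (fun i => r (i + N))]
    simp only [zero_add]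
    linarith

lemma contract_aux1 (a b x y lam : ℝ) (ha : 0 < a) (hb : 0 < b) (hx : 0 < x) (hxy : x ≤ y)
    (hlam : b / (a * x + b) ≤ lam) :
    |Real.log (a + b / x) - Real.log (a + b / y)| ≤ lam * |Real.log x - Real.log y| := by
  have hy : 0 < y := hx.trans_le hxy
  have hle : Real.log x ≤ Real.log y := Real.log_le_log hx hxy
  have hax : 0 < a * x + b := by positivity
  have h2 : Real.log (a + b / y) ≤ Real.log (a + b / x) := by
    apply Real.log_le_log (by positivity)
    gcongr
  have hc0 := strictConcaveOn_log_Ioi.concaveOn.2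
  have hc := hc0 (show x / y ∈ Set.Ioi (0 : ℝ) from Set.mem_Ioi.2 (by positivity))
    (show (1 : ℝ) ∈ Set.Ioi (0 : ℝ) from Set.mem_Ioi.2 one_pos)
    (show 0 ≤ b / (a * x + b) by positivity) (show 0 ≤ a * x / (a * x + b) by positivity)
    (by field_simp; ring)
  simp only [smul_eq_mul, Real.log_one, mul_zero, add_zero, mul_one] at hc
  have he : b / (a * x + b) * (x / y) + a * x / (a * x + b) = (a + b / y) / (a + b / x) := by
    field_simp
    ring
  rw [he, Real.log_div hx.ne' hy.ne', Real.log_div (by positivity) (by positivity)] at hc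
  rw [abs_of_nonneg (sub_nonneg.2 h2), abs_sub_comm, abs_of_nonneg (sub_nonneg.2 hle)]
  have := mul_le_mul_of_nonneg_right hlam (sub_nonneg.2 hle)
  linarith

lemma contract_aux (a b x y L B lam : ℝ) (hL : 0 < L) (hLa : L ≤ a) (hb : 0 < b) (hbB : b ≤ B)
    (hx : L ≤ x) (hy : L ≤ y) (hlam : lam = B / (L * L + B)) :
    |Real.log (a + b / x) - Real.log (a + b / y)| ≤ lam * |Real.log x - Real.log y| := by
  have ha : 0 < a := hL.trans_le hLa
  have key : ∀ z, L ≤ z → b / (a * z + b) ≤ lam := by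
    intro z hz
    have hz0 : 0 < z := hL.trans_le hz
    have h1 : L * L ≤ a * z := mul_le_mul hLa hz hL.le ha.le
    have hB : 0 < B := hb.trans_le hbB
    rw [hlam, div_le_div_iff₀ (by positivity) (by positivity)]
    have h2 : b * (L * L) ≤ B * (a * z) := mul_le_mul hbB h1 (by positivity) hB.le
    nlinarith
  rcases le_total x y with h | h
  · exact contract_aux1 a b x y lam ha hb (hL.trans_le hx) h (key x hx)
  · have := contract_aux1 a b y x lam ha hb (hL.trans_le hy) h (key y hy)
    rwa [abs_sub_comm, abs_sub_comm (Real.log y)] at this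

lemma rho_pos_aux (a b : ℕ → ℝ) (k : ℕ) (ha : 0 < a k) (hb : 0 < b k) :
    a k ≤ rhoG a b k ∧ rhoG a b k = a k + b k / rhoG a b k := by
  have h1 : a k ≤ Real.sqrt (a k ^ 2 + 4 * b k) := Real.le_sqrt_of_sq_le (by linarith)
  have h2 := Real.sq_sqrt (show 0 ≤ a k ^ 2 + 4 * b k by positivity)
  have h3 : a k ≤ rhoG a b k := by unfold rhoG; linarith
  refine ⟨h3, ?_⟩
  have h4 : 0 < rhoG a b k := ha.trans_le h3
  have h5 : rhoG a b k * rhoG a b k = a k * rhoG a b k + b k := by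
    unfold rhoG; nlinarith
  field_simp
  nlinarith

lemma prodAsc_zero_aux (a b : ℕ → ℝ) (k : ℕ) : prodAscG a b k (k + 0 + 1) = AmatG a b k := by
  simp [prodAscG]

lemma prodAsc_succ_aux (a b : ℕ → ℝ) (k n : ℕ) :
    prodAscG a b k (k + (n + 1) + 1) = AmatG a b k * prodAscG a b (k + 1) (k + 1 + n + 1) := by
  unfold prodAscG
  rw [show k + (n + 1) + 1 - k = (n + 1) + 1 by omega,
    show k + 1 + n + 1 - (k + 1) = n + 1 by omega, List.range_succ_eq_map]
  simp only [List.map_cons, List.prod_cons, List.map_map, add_zero]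
  congr 2
  apply List.map_congr_left
  intro i _
  simp only [Function.comp, Nat.succ_eq_add_one]
  congr 1
  omega

lemma main_aux (a b : ℕ → ℝ) (L B D lam : ℝ) (hL : 0 < L) (hlam : lam = B / (L * L + B))
    (hlam0 : 0 ≤ lam) (hlam1 : lam < 1)
    (hLa : ∀ k, 2 ≤ k → L ≤ a k) (hb : ∀ k, 2 ≤ k → 0 < b k) (hbB : ∀ k, 2 ≤ k → b k ≤ B)
    (hD : ∀ k, 2 ≤ k → |Real.log (a k) - Real.log (rhoG a b k)| ≤ D) (n : ℕ) :
    ∀ k, 2 ≤ k → ∃ x : ℝ, L ≤ x ∧ 0 < prodAscG a b k (k + n + 1) 1 0 ∧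
      prodAscG a b k (k + n + 1) 0 0 = x * prodAscG a b k (k + n + 1) 1 0 ∧
      (1 - lam) * |Real.log (prodAscG a b k (k + n + 1) 0 0)
          - ∑ j ∈ Finset.Icc k (k + n), Real.log (rhoG a b j)|
        + lam * |Real.log x - Real.log (rhoG a b k)| ≤
      D + ∑ j ∈ Finset.Ico k (k + n),
        |Real.log (rhoG a b (j + 1)) - Real.log (rhoG a b j)| := by
  induction n with
  | zero =>
    intro k hk
    refine ⟨a k, hLa k hk, ?_⟩
    rw [prodAsc_zero_aux]
    simp only [AmatG, Matrix.of_apply, Matrix.cons_val', Matrix.cons_val_zero,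
      Matrix.cons_val_one, add_zero, Finset.Icc_self, Finset.sum_singleton, Finset.Ico_self,
      Finset.sum_empty]
    refine ⟨one_pos, (mul_one _).symm, ?_⟩
    have := hD k hk
    linarith
  | succ n ih =>
    intro k hk
    obtain ⟨x, hx, hp, he, hs⟩ := ih (k + 1) (by omega)
    have hx0 : 0 < x := hL.trans_le hx
    have hak : 0 < a k := hL.trans_le (hLa k hk)
    have hbk := hb k hk
    obtain ⟨hr1, hr2⟩ := rho_pos_aux a b k hak hbk
    have hr0 := hak.trans_le hr1
    have e10 : prodAscG a b k (k + (n + 1) + 1) 1 0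
        = prodAscG a b (k + 1) (k + 1 + n + 1) 0 0 := by
      rw [prodAsc_succ_aux]
      simp [AmatG, Matrix.mul_apply, Fin.sum_univ_two]
    have e00 : prodAscG a b k (k + (n + 1) + 1) 0 0
        = (a k + b k / x) * prodAscG a b (k + 1) (k + 1 + n + 1) 0 0 := by
      rw [prodAsc_succ_aux]
      simp only [AmatG, Matrix.mul_apply, Fin.sum_univ_two, Matrix.of_apply, Matrix.cons_val',
        Matrix.cons_val_zero, Matrix.cons_val_one]
      rw [he]
      field_simp
    have hP : 0 < prodAscG a b (k + 1) (k + 1 + n + 1) 0 0 := by rw [he]; positivity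
    have hx' : 0 < a k + b k / x := by positivity
    refine ⟨a k + b k / x, ?_, ?_, ?_, ?_⟩
    · have : 0 < b k / x := by positivity
      linarith [hLa k hk]
    · rw [e10]; exact hP
    · rw [e10, e00]
    · rw [e00, Real.log_mul hx'.ne' hP.ne']
      have hc := contract_aux (a k) (b k) x (rhoG a b k) L B lam hL (hLa k hk) hbk (hbB k hk) hx
        ((hLa k hk).trans hr1) hlam
      rw [← hr2] at hc
      have s1 : ∑ j ∈ Finset.Icc k (k + (n + 1)), Real.log (rhoG a b j)
          = Real.log (rhoG a b k)
            + ∑ j ∈ Finset.Icc (k + 1) (k + 1 + n), Real.log (rhoG a b j) := by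
        rw [show k + (n + 1) = k + 1 + n by omega,
          ← Finset.insert_Icc_add_one_left_eq_Icc (by omega : k ≤ k + 1 + n),
          Finset.sum_insert (by simp)]
      have s2 : ∑ j ∈ Finset.Ico k (k + (n + 1)),
            |Real.log (rhoG a b (j + 1)) - Real.log (rhoG a b j)|
          = |Real.log (rhoG a b (k + 1)) - Real.log (rhoG a b k)|
            + ∑ j ∈ Finset.Ico (k + 1) (k + 1 + n),
              |Real.log (rhoG a b (j + 1)) - Real.log (rhoG a b j)| := by
        rw [show k + (n + 1) = k + 1 + n by omega,
          Finset.sum_eq_sum_Ico_succ_bot (by omega : k < k + 1 + n)]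
      rw [s1, s2]
      generalize (∑ j ∈ Finset.Icc (k + 1) (k + 1 + n), Real.log (rhoG a b j)) = S at *
      generalize (∑ j ∈ Finset.Ico (k + 1) (k + 1 + n),
              |Real.log (rhoG a b (j + 1)) - Real.log (rhoG a b j)|) = T at *
      generalize Real.log (prodAscG a b (k + 1) (k + 1 + n + 1) 0 0) = P at *
      generalize Real.log (a k + b k / x) = X' at *
      generalize Real.log x = X at *
      generalize Real.log (rhoG a b k) = r at *
      generalize Real.log (rhoG a b (k + 1)) = r' at *
      have t1 : |X' + P - (r + S)| ≤ |X' - r| + |P - S| := by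
        rw [show X' + P - (r + S) = (X' - r) + (P - S) by ring]
        exact abs_add_le _ _
      have t2 : |X - r| ≤ |X - r'| + |r' - r| := abs_sub_le _ _ _
      have t3 := mul_le_mul_of_nonneg_left t1 (by linarith : 0 ≤ 1 - lam)
      have t4 := mul_le_mul_of_nonneg_left t2 hlam0
      have t5 : lam * |r' - r| ≤ |r' - r| :=
        mul_le_of_le_one_left (abs_nonneg _) hlam1.le
      linarith

theorem matrix_product_spectral_comparison
    (aseq bseq : ℕ → ℝ)
    (haseq : ∀ k, 2 ≤ k → 0 < aseq k) (hbseq : ∀ k, 2 ≤ k → 0 < bseq k)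
    (a b : ℝ) (ha : 0 < a) (hb : 0 < b)
    (hCa : Tendsto aseq atTop (𝓝 a))
    (hCb : Tendsto bseq atTop (𝓝 b))
    (N₀ : ℕ)
    (hmono : (∀ k l, N₀ ≤ k → k ≤ l → rhoG aseq bseq k ≤ rhoG aseq bseq l) ∨
      (∀ k l, N₀ ≤ k → k ≤ l → rhoG aseq bseq l ≤ rhoG aseq bseq k)) :
    ∃ c₅ c₆ : ℝ, 0 < c₅ ∧ c₅ < c₆ ∧
      ∀ k m : ℕ, 2 ≤ k → k ≤ m →
        c₅ < prodAscG aseq bseq k (m + 1) 0 0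
            / ∏ i ∈ Finset.Icc k m, rhoG aseq bseq i ∧
        prodAscG aseq bseq k (m + 1) 0 0
            / ∏ i ∈ Finset.Icc k m, rhoG aseq bseq i < c₆ := by
  obtain ⟨Ra, hRa0, hRa⟩ := log_bdd_aux aseq a ha hCa
  obtain ⟨Rb, hRb0, hRb⟩ := log_bdd_aux bseq b hb hCb
  have hCr : Tendsto (rhoG aseq bseq) atTop (𝓝 ((a + Real.sqrt (a ^ 2 + 4 * b)) / 2)) := by
    unfold rhoG
    exact (hCa.add (((hCa.pow 2).add (hCb.const_mul 4)).sqrt)).div_const 2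
  obtain ⟨R, hR0, hR⟩ := log_bdd_aux _ _ (by positivity) hCr
  have hrpos : ∀ k, 2 ≤ k → 0 < rhoG aseq bseq k := fun k hk =>
    (haseq k hk).trans_le (rho_pos_aux aseq bseq k (haseq k hk) (hbseq k hk)).1
  have hsum : Summable (fun j => |Real.log (rhoG aseq bseq (j + 1))
      - Real.log (rhoG aseq bseq j)|) := by
    refine variation_aux (fun j => Real.log (rhoG aseq bseq j)) R hR (max N₀ 2) ?_
    rcases hmono with h | h
    · left
      intro k l hk hl
      exact Real.log_le_log (hrpos k (le_of_max_le_right hk)) (h k l (le_of_max_le_left hk) hl)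
    · right
      intro k l hk hl
      exact Real.log_le_log (hrpos l ((le_of_max_le_right hk).trans hl))
        (h k l (le_of_max_le_left hk) hl)
  obtain ⟨V, hV⟩ : ∃ V, V = ∑' j, |Real.log (rhoG aseq bseq (j + 1))
      - Real.log (rhoG aseq bseq j)| := ⟨_, rfl⟩
  obtain ⟨L, hLdef⟩ : ∃ L, L = Real.exp (-Ra) := ⟨_, rfl⟩
  obtain ⟨B, hBdef⟩ : ∃ B, B = Real.exp Rb := ⟨_, rfl⟩
  have hL : 0 < L := hLdef ▸ Real.exp_pos _
  have hB : 0 < B := hBdef ▸ Real.exp_pos _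
  obtain ⟨lam, hlam⟩ : ∃ lam, lam = B / (L * L + B) := ⟨_, rfl⟩
  have hlam0 : 0 ≤ lam := by rw [hlam]; positivity
  have hlam1 : lam < 1 := by
    rw [hlam, div_lt_one (by positivity)]
    nlinarith
  have hLa : ∀ k, 2 ≤ k → L ≤ aseq k := by
    intro k hk
    rw [hLdef, ← Real.le_log_iff_exp_le (haseq k hk)]
    exact (abs_le.1 (hRa k)).1
  have hbB : ∀ k, 2 ≤ k → bseq k ≤ B := by
    intro k hk
    rw [hBdef, ← Real.log_le_iff_le_exp (hbseq k hk)]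
    exact (abs_le.1 (hRb k)).2
  have hD : ∀ k, 2 ≤ k → |Real.log (aseq k) - Real.log (rhoG aseq bseq k)| ≤ Ra + R := by
    intro k _
    exact (abs_sub _ _).trans (add_le_add (hRa k) (hR k))
  have h1l : 0 < 1 - lam := by linarith
  have hV0 : 0 ≤ V := hV ▸ tsum_nonneg (fun _ => abs_nonneg _)
  obtain ⟨K, hK⟩ : ∃ K, K = (Ra + R + V) / (1 - lam) := ⟨_, rfl⟩
  have hK0 : 0 ≤ K := by rw [hK]; positivity
  refine ⟨Real.exp (-(K + 1)), Real.exp (K + 1), Real.exp_pos _,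
    Real.exp_lt_exp.2 (by linarith), ?_⟩
  intro k m hk hkm
  obtain ⟨n, rfl⟩ := Nat.exists_eq_add_of_le hkm
  obtain ⟨x, hx, hp, he, hs⟩ := main_aux aseq bseq L B (Ra + R) lam hL hlam hlam0 hlam1 hLa hbseq
    hbB hD n k hk
  have hx0 : 0 < x := hL.trans_le hx
  have hP : 0 < prodAscG aseq bseq k (k + n + 1) 0 0 := by rw [he]; positivity
  have hne : ∀ j ∈ Finset.Icc k (k + n), 0 < rhoG aseq bseq j := fun j hj =>
    hrpos j (hk.trans (Finset.mem_Icc.1 hj).1)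
  have hQ : 0 < ∏ i ∈ Finset.Icc k (k + n), rhoG aseq bseq i := Finset.prod_pos hne
  have hT : ∑ j ∈ Finset.Ico k (k + n), |Real.log (rhoG aseq bseq (j + 1))
      - Real.log (rhoG aseq bseq j)| ≤ V := by
    rw [hV]
    exact hsum.sum_le_tsum _ (fun _ _ => abs_nonneg _)
  have hfin : |Real.log (prodAscG aseq bseq k (k + n + 1) 0 0
      / ∏ i ∈ Finset.Icc k (k + n), rhoG aseq bseq i)| ≤ K := by
    rw [Real.log_div hP.ne' hQ.ne', Real.log_prod (fun j hj => (hne j hj).ne'), hK,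
      le_div_iff₀ h1l]
    have : 0 ≤ lam * |Real.log x - Real.log (rhoG aseq bseq k)| := by positivity
    linarith
  have hfin' := abs_le.1 hfin
  have hdiv := div_pos hP hQ
  constructor
  · rw [← Real.lt_log_iff_exp_lt hdiv]
    linarith
  · rw [← Real.log_lt_iff_lt_exp hdiv]
    linarith

end
end

section
/- Suppose Condition (C) holds and that ρ_k is monotone in k for k ≥ N₀, for some N₀. Then both D_X(n) and D_Y(n) are monotone in n for n > N₀, and there exist constants 0 < c₇ < c₈ < ∞ such that for all n > m ≥ 1: c₇ D_X(m) ≤ F_X(m) ≤ c₈ D_X(m); c₇ D_Y(m) ≤ F_Y(m) ≤ c₈ D_Y(m); and c₇ D_Y(m,n) ≤ F_Y(m,n) ≤ c₈ D_Y(m,n) (inequalities understood in the extended reals when the quantities are infinite). -/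
open Filter Topology ENNReal

noncomputable section

/-- The ordered product `A_s A_{s-1} ⋯ A_{m+1}`, indices decreasing from `s`
down to `m+1` (identity when `s ≤ m`). -/
def prodDescG (a b : ℕ → ℝ) (s m : ℕ) : Matrix (Fin 2) (Fin 2) ℝ :=
  ((List.range (s - m)).map fun i => AmatG a b (s - i)).prod

/-- `D_X(n) = 1 + Σ_{j=n+1}^∞ Π_{i=n+1}^j ρ_i ∈ (0,∞]`. -/
def DXG (a b : ℕ → ℝ) (n : ℕ) : ℝ≥0∞ :=
  1 + ∑' j : ℕ, ENNReal.ofReal (∏ i ∈ Finset.Icc (n + 1) (n + 1 + j), rhoG a b i)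

/-- `D_Y(n) = 1 + Σ_{j=n+1}^∞ Π_{i=n+1}^j ρ_i⁻¹ ∈ (0,∞]`. -/
def DYG (a b : ℕ → ℝ) (n : ℕ) : ℝ≥0∞ :=
  1 + ∑' j : ℕ, ENNReal.ofReal (∏ i ∈ Finset.Icc (n + 1) (n + 1 + j), (rhoG a b i)⁻¹)

/-- `D_Y(m,n) = 1 + Σ_{j=m+1}^{n-1} Π_{i=m+1}^j ρ_i⁻¹`. -/
def DYfinG (a b : ℕ → ℝ) (m n : ℕ) : ℝ :=
  1 + ∑ j ∈ Finset.Icc (m + 1) (n - 1), ∏ i ∈ Finset.Icc (m + 1) j, (rhoG a b i)⁻¹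

/-- `F_X(m) = lim_{n→∞} F_X(m,n) = 1 + Σ_{s=m+1}^∞ e₁ A_s⋯A_{m+1} e₁ᵗ ∈ (0,∞]`. -/
def FXG (a b : ℕ → ℝ) (m : ℕ) : ℝ≥0∞ :=
  1 + ∑' j : ℕ, ENNReal.ofReal (prodDescG a b (m + 1 + j) m 0 0)

/-- `ζ_{k,n} = (e₁ A_{k+1}⋯A_n e₁ᵗ)/(e₁ A_k⋯A_n e₁ᵗ)`. -/
def zetaApproxG (a b : ℕ → ℝ) (k n : ℕ) : ℝ :=
  prodAscG a b (k + 1) (n + 1) 0 0 / prodAscG a b k (n + 1) 0 0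

/-- `F_Y(m,n) = 1 + Σ_{j=m+1}^{n-1} Π_{i=m+1}^{j} ζ_i`. -/
def FYfinG (ζ : ℕ → ℝ) (m n : ℕ) : ℝ :=
  1 + ∑ j ∈ Finset.Icc (m + 1) (n - 1), ∏ i ∈ Finset.Icc (m + 1) j, ζ i

/-- `F_Y(m) = lim_{n→∞} F_Y(m,n) ∈ (0,∞]` (the limit of the nondecreasing
sequence `F_Y(m,n)`, realized as a supremum in `ℝ≥0∞`). -/
def FYinfG (ζ : ℕ → ℝ) (m : ℕ) : ℝ≥0∞ :=
  ⨆ n : ℕ, ENNReal.ofReal (FYfinG ζ m n)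

/-- A sequence with positive limit, positive from index 2 on, is bounded and bounded away from 0. -/
lemma aux_bounds (x : ℕ → ℝ) (L : ℝ) (hL : 0 < L) (hx : ∀ k, 2 ≤ k → 0 < x k)
    (hT : Tendsto x atTop (𝓝 L)) :
    ∃ c C : ℝ, 0 < c ∧ 0 < C ∧ ∀ k, 2 ≤ k → c ≤ x k ∧ x k ≤ C := by
  obtain ⟨C, hC⟩ := hT.bddAbove_range
  have hinv : Tendsto (fun k => (x k)⁻¹) atTop (𝓝 L⁻¹) := hT.inv₀ hL.ne'
  obtain ⟨D, hD⟩ := hinv.bddAbove_range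
  have hC' : ∀ k, x k ≤ C := fun k => hC ⟨k, rfl⟩
  have hD' : ∀ k, (x k)⁻¹ ≤ D := fun k => hD ⟨k, rfl⟩
  have hDpos : 0 < D := lt_of_lt_of_le (inv_pos.2 (hx 2 le_rfl)) (hD' 2)
  have hCpos : 0 < C := lt_of_lt_of_le (hx 2 le_rfl) (hC' 2)
  refine ⟨D⁻¹, C, inv_pos.2 hDpos, hCpos, fun k hk => ⟨?_, hC' k⟩⟩
  exact inv_le_of_inv_le₀ (hx k hk) (hD' k)

/-- Monotone weights controlling the variation of `r`. -/
lemma aux_weights (r : ℕ → ℝ) (c C : ℝ) (hc : 0 < c)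
    (hr : ∀ k, 2 ≤ k → c ≤ r k ∧ r k ≤ C) (N₀ : ℕ)
    (hmono : (∀ k l, N₀ ≤ k → k ≤ l → r k ≤ r l) ∨ (∀ k l, N₀ ≤ k → k ≤ l → r l ≤ r k)) :
    ∃ (h H : ℕ → ℝ) (hs Hs : ℝ), 0 < hs ∧ 0 < Hs ∧ (∀ k, hs ≤ h k ∧ h k ≤ 1) ∧
      (∀ k, 1 ≤ H k ∧ H k ≤ Hs) ∧ (∀ k, h (k+1) ≤ h k) ∧ (∀ k, H k ≤ H (k+1)) ∧
      (∀ k, 2 ≤ k → h (k+1) * r k ≤ r (k+1) * h k) ∧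
      (∀ k, 2 ≤ k → r (k+1) * H k ≤ H (k+1) * r k) := by
  have hpos : ∀ k, 2 ≤ k → 0 < r k := fun k hk => lt_of_lt_of_le hc (hr k hk).1
  set s : ℕ → ℝ := fun i => if 2 ≤ i then r (i+1) / r i else 1 with hs
  have hspos : ∀ i, 0 < s i := by
    intro i
    simp only [hs]
    split_ifs with hi
    · exact div_pos (hpos _ (by omega)) (hpos _ hi)
    · exact one_pos
  set h : ℕ → ℝ := fun k => ∏ i ∈ Finset.range k, min 1 (s i) with hh
  set H : ℕ → ℝ := fun k => ∏ i ∈ Finset.range k, max 1 (s i) with hH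
  have hsucc : ∀ k, h (k+1) = h k * min 1 (s k) := fun k => Finset.prod_range_succ _ _
  have Hsucc : ∀ k, H (k+1) = H k * max 1 (s k) := fun k => Finset.prod_range_succ _ _
  have hhpos : ∀ k, 0 < h k := fun k => Finset.prod_pos fun i _ => lt_min one_pos (hspos i)
  have hHpos : ∀ k, 0 < H k := fun k => Finset.prod_pos fun i _ => lt_max_of_lt_left one_pos
  have hdec : ∀ k, h (k+1) ≤ h k := fun k => by
    rw [hsucc]; exact mul_le_of_le_one_right (hhpos k).le (min_le_left _ _)
  have Hinc : ∀ k, H k ≤ H (k+1) := fun k => by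
    rw [Hsucc]; exact le_mul_of_one_le_right (hHpos k).le (le_max_left _ _)
  have hanti : Antitone h := antitone_nat_of_succ_le hdec
  have Hmon : Monotone H := monotone_nat_of_le_succ Hinc
  have h0 : h 0 = 1 := by simp [hh]
  have H0 : H 0 = 1 := by simp [hH]
  have hle : ∀ k, h k ≤ 1 := fun k => h0 ▸ hanti (Nat.zero_le k)
  have Hge : ∀ k, 1 ≤ H k := fun k => H0 ▸ Hmon (Nat.zero_le k)
  have hprod : ∀ k, h (k+2) * H (k+2) * r 2 = r (k+2) := by
    intro k
    induction k with
    | zero =>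
      have e : ∀ i, i < 2 → s i = 1 := fun i hi => by simp only [hs]; rw [if_neg (by omega)]
      have e1 : h 2 = 1 := by simp [hh, Finset.prod_range_succ, e]
      have e2 : H 2 = 1 := by simp [hH, Finset.prod_range_succ, e]
      simp [e1, e2]
    | succ k ih =>
      have e : s (k+2) = r (k+3) / r (k+2) := by simp [hs]
      have hm : min 1 (s (k+2)) * max 1 (s (k+2)) = s (k+2) := by rw [min_mul_max, one_mul]
      have := hpos (k+2) (by omega)
      rw [show k + 1 + 2 = (k+2)+1 by ring, hsucc, Hsucc]
      calc h (k+2) * min 1 (s (k+2)) * (H (k+2) * max 1 (s (k+2))) * r 2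
          = (h (k+2) * H (k+2) * r 2) * (min 1 (s (k+2)) * max 1 (s (k+2))) := by ring
        _ = r (k+2+1) := by rw [ih, hm, e]; field_simp
  have key : (∃ hs, 0 < hs ∧ ∀ k, hs ≤ h k) ∧ (∃ Hs, 0 < Hs ∧ ∀ k, H k ≤ Hs) := by
    have hCpos : 0 < C := lt_of_lt_of_le hc ((hr 2 le_rfl).1.trans (hr 2 le_rfl).2)
    rcases hmono with hm | hm
    · have hconst : ∀ k, h (N₀+2) ≤ h k := by
        have h1 : ∀ j, h (N₀+2+j) = h (N₀+2) := by
          intro j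
          induction j with
          | zero => rfl
          | succ j ih =>
            rw [← add_assoc, hsucc, ih, min_eq_left, mul_one]
            simp only [hs]
            rw [if_pos (by omega), one_le_div (hpos _ (by omega))]
            exact hm _ _ (by omega) (by omega)
        intro k
        rw [← h1 k]
        exact hanti (by omega)
      refine ⟨⟨_, hhpos _, hconst⟩, C / (h (N₀+2) * r 2), ?_, ?_⟩
      · exact div_pos hCpos (mul_pos (hhpos _) (hpos 2 le_rfl))
      · intro k
        refine (Hmon (show k ≤ k + 2 by omega)).trans ?_
        rw [le_div_iff₀ (mul_pos (hhpos _) (hpos 2 le_rfl))]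
        calc H (k+2) * (h (N₀+2) * r 2) ≤ H (k+2) * (h (k+2) * r 2) := by
              have := hconst (k+2); have := hHpos (k+2); have := hpos 2 le_rfl
              gcongr
          _ = r (k+2) := by rw [← hprod k]; ring
          _ ≤ C := (hr _ (by omega)).2
    · have Hconst : ∀ k, H k ≤ H (N₀+2) := by
        have h1 : ∀ j, H (N₀+2+j) = H (N₀+2) := by
          intro j
          induction j with
          | zero => rfl
          | succ j ih =>
            rw [← add_assoc, Hsucc, ih, max_eq_left, mul_one]
            simp only [hs]
            rw [if_pos (by omega), div_le_one (hpos _ (by omega))]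
            exact hm _ _ (by omega) (by omega)
        intro k
        rw [← h1 k]
        exact Hmon (by omega)
      refine ⟨⟨c / (H (N₀+2) * r 2), ?_, ?_⟩, _, hHpos _, Hconst⟩
      · exact div_pos hc (mul_pos (hHpos _) (hpos 2 le_rfl))
      · intro k
        refine le_trans ?_ (hanti (show k ≤ k + 2 by omega))
        rw [div_le_iff₀ (mul_pos (hHpos _) (hpos 2 le_rfl))]
        calc c ≤ r (k+2) := (hr _ (by omega)).1
          _ = h (k+2) * (H (k+2) * r 2) := by rw [← hprod k]; ring
          _ ≤ h (k+2) * (H (N₀+2) * r 2) := by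
              have := Hconst (k+2); have := hhpos (k+2); have := hpos 2 le_rfl
              gcongr
  obtain ⟨⟨hl, hl0, hl1⟩, Hl, Hl0, Hl1⟩ := key
  refine ⟨h, H, hl, Hl, hl0, Hl0, fun k => ⟨hl1 k, hle k⟩, fun k => ⟨Hge k, Hl1 k⟩, hdec, Hinc,
    ?_, ?_⟩
  · intro k hk
    have e : s k * r k = r (k+1) := by
      simp only [hs]; rw [if_pos hk]; field_simp [(hpos k hk).ne']
    calc h (k+1) * r k = h k * min 1 (s k) * r k := by rw [hsucc]
      _ ≤ h k * s k * r k := by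
        have := min_le_right 1 (s k); have := hhpos k; have := hpos k hk
        gcongr
      _ = r (k+1) * h k := by rw [← e]; ring
  · intro k hk
    have e : s k * r k = r (k+1) := by
      simp only [hs]; rw [if_pos hk]; field_simp [(hpos k hk).ne']
    calc r (k+1) * H k = H k * s k * r k := by rw [← e]; ring
      _ ≤ H k * max 1 (s k) * r k := by
        have := le_max_right 1 (s k); have := hHpos k; have := hpos k hk
        gcongr
      _ = H (k+1) * r k := by rw [Hsucc]

lemma aux_rho_pos (a b : ℕ → ℝ) (k : ℕ) (ha : 0 < a k) : 0 < rhoG a b k := by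
  unfold rhoG
  have := Real.sqrt_nonneg (a k ^ 2 + 4 * b k)
  linarith

lemma aux_rho_sq (a b : ℕ → ℝ) (k : ℕ) (hb : 0 < b k) :
    rhoG a b k * rhoG a b k = a k * rhoG a b k + b k := by
  unfold rhoG
  have := Real.mul_self_sqrt (show 0 ≤ a k ^ 2 + 4 * b k by positivity)
  nlinarith

lemma aux_desc_zero (a b : ℕ → ℝ) (m : ℕ) : prodDescG a b m m = 1 := by
  simp [prodDescG]

lemma aux_desc_succ (a b : ℕ → ℝ) (m j : ℕ) :
    prodDescG a b (m + (j+1)) m = AmatG a b (m + (j+1)) * prodDescG a b (m + j) m := by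
  unfold prodDescG
  rw [show m + (j+1) - m = j + 1 by omega, show m + j - m = j by omega,
    List.range_succ_eq_map, List.map_cons, List.prod_cons, List.map_map]
  congr 3
  funext i
  simp only [Function.comp]
  congr 1
  omega

lemma aux_asc_succ (a b : ℕ → ℝ) (k n : ℕ) (h : k < n) :
    prodAscG a b k n = AmatG a b k * prodAscG a b (k+1) n := by
  unfold prodAscG
  obtain ⟨d, rfl⟩ : ∃ d, n = k + 1 + d := ⟨n - (k+1), by omega⟩
  rw [show k + 1 + d - k = d + 1 by omega, show k + 1 + d - (k+1) = d by omega,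
    List.range_succ_eq_map, List.map_cons, List.prod_cons, List.map_map]
  congr 3
  funext i
  simp only [Function.comp]
  congr 1
  omega

lemma aux_Amul (a b : ℕ → ℝ) (k : ℕ) (M : Matrix (Fin 2) (Fin 2) ℝ) :
    (AmatG a b k * M) 0 0 = a k * M 0 0 + b k * M 1 0 ∧ (AmatG a b k * M) 1 0 = M 0 0 := by
  constructor <;> simp [AmatG, Matrix.mul_apply, Fin.sum_univ_two]

/-- One step of the lower comparison. -/
lemma aux_step_lower {a b r r' R A w0 w1 w2 u1 u0 : ℝ} (ha : 0 < a) (hb : 0 < b) (hr : 0 < r)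
    (hr' : 0 < r') (hR : 0 ≤ R) (hA : 0 ≤ A) (hsq : r * r = a * r + b)
    (h01 : w2 ≤ w1) (h02 : w2 * r' ≤ r * w0)
    (h1 : A * w1 * (r' * R) ≤ u1) (h0 : A * w0 * R ≤ u0) :
    A * w2 * (r * (r' * R)) ≤ a * u1 + b * u0 := by
  have e : w2 * r * r' ≤ a * w1 * r' + b * w0 := by
    have : r * (w2 * r * r') ≤ r * (a * w1 * r' + b * w0) := by
      have e1 : r * (w2 * r * r') = (a * r + b) * w2 * r' := by rw [← hsq]; ring
      have e2 : a * r * r' * w2 ≤ a * r * r' * w1 := by gcongr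
      have e3 : b * (w2 * r') ≤ b * (r * w0) := by gcongr
      nlinarith
    exact le_of_mul_le_mul_left this hr
  calc A * w2 * (r * (r' * R)) = (A * R) * (w2 * r * r') := by ring
    _ ≤ (A * R) * (a * w1 * r' + b * w0) := by gcongr
    _ = a * (A * w1 * (r' * R)) + b * (A * w0 * R) := by ring
    _ ≤ _ := by gcongr

/-- One step of the upper comparison. -/
lemma aux_step_upper {a b r r' R A w0 w1 w2 u1 u0 : ℝ} (ha : 0 < a) (hb : 0 < b) (hr : 0 < r)
    (hr' : 0 < r') (hR : 0 ≤ R) (hA : 0 ≤ A) (hsq : r * r = a * r + b)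
    (h01 : w1 ≤ w2) (h02 : r * w0 ≤ w2 * r')
    (h1 : u1 ≤ A * w1 * (r' * R)) (h0 : u0 ≤ A * w0 * R) :
    a * u1 + b * u0 ≤ A * w2 * (r * (r' * R)) := by
  have := @aux_step_lower a b r r' R A (-w0) (-w1) (-w2) (-u1) (-u0) ha hb hr hr' hR hA hsq
    (by linarith) (by linarith) (by linarith) (by linarith)
  linarith

lemma aux_FX (a b h H : ℕ → ℝ) (α : ℝ) (hα : 0 ≤ α) (hα1 : α ≤ 1)
    (ha : ∀ k, 2 ≤ k → 0 < a k) (hb : ∀ k, 2 ≤ k → 0 < b k)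
    (hαa : ∀ k, 2 ≤ k → α * rhoG a b k ≤ a k)
    (h1 : ∀ k, 0 < h k ∧ h k ≤ 1) (H1 : ∀ k, 1 ≤ H k)
    (hd : ∀ k, h (k+1) ≤ h k) (Hi : ∀ k, H k ≤ H (k+1))
    (hh : ∀ k, 2 ≤ k → h (k+1) * rhoG a b k ≤ rhoG a b (k+1) * h k)
    (HH : ∀ k, 2 ≤ k → rhoG a b (k+1) * H k ≤ H (k+1) * rhoG a b k)
    (m : ℕ) (hm : 1 ≤ m) (j : ℕ) :
    α * h (m+j) * ∏ i ∈ Finset.range j, rhoG a b (m+1+i) ≤ prodDescG a b (m+j) m 0 0 ∧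
    prodDescG a b (m+j) m 0 0 ≤ 1 * H (m+j) * ∏ i ∈ Finset.range j, rhoG a b (m+1+i) := by
  have hpos : ∀ k, 2 ≤ k → 0 < rhoG a b k := fun k hk => aux_rho_pos a b k (ha k hk)
  have hsq : ∀ k, 2 ≤ k → _ := fun k hk => aux_rho_sq a b k (hb k hk)
  induction j using Nat.twoStepInduction with
  | zero =>
    simp only [add_zero, aux_desc_zero, Finset.range_zero, Finset.prod_empty, mul_one, one_mul,
      Matrix.one_apply_eq]
    exact ⟨mul_le_one₀ hα1 (h1 m).1.le (h1 m).2, H1 m⟩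
  | one =>
    have e : prodDescG a b (m+1) m 0 0 = a (m+1) := by
      have := (aux_Amul a b (m+(0+1)) (prodDescG a b (m+0) m)).1
      rw [← aux_desc_succ, add_zero, aux_desc_zero] at this
      simpa using this
    rw [e]
    simp only [Finset.prod_range_one, add_zero, one_mul]
    have hk : 2 ≤ m + 1 := by omega
    have p := hpos _ hk
    constructor
    · calc α * h (m+1) * rhoG a b (m+1) ≤ α * 1 * rhoG a b (m+1) := by
            have := (h1 (m+1)).2
            gcongr
        _ ≤ a (m+1) := by rw [mul_one]; exact hαa _ hk
    · have q1 : a (m+1) ≤ rhoG a b (m+1) := by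
        have := hsq _ hk; have := hb _ hk
        by_contra hcon
        push Not at hcon
        nlinarith
      exact q1.trans (le_mul_of_one_le_left p.le (H1 _))
  | more j ih0 ih1 =>
    have e : prodDescG a b (m+(j+2)) m 0 0
        = a (m+(j+2)) * prodDescG a b (m+(j+1)) m 0 0
          + b (m+(j+2)) * prodDescG a b (m+j) m 0 0 := by
      rw [show j + 2 = (j+1)+1 by rfl, aux_desc_succ, (aux_Amul _ _ _ _).1]
      rw [aux_desc_succ a b m j, (aux_Amul _ _ _ _).2]
    have hk : 2 ≤ m + (j+2) := by omega
    have hk' : 2 ≤ m + (j+1) := by omega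
    have eR1 : ∏ i ∈ Finset.range (j+1), rhoG a b (m+1+i)
        = rhoG a b (m+(j+1)) * ∏ i ∈ Finset.range j, rhoG a b (m+1+i) := by
      rw [Finset.prod_range_succ, mul_comm, show m + 1 + j = m + (j+1) by ring]
    have eR2 : ∏ i ∈ Finset.range (j+2), rhoG a b (m+1+i)
        = rhoG a b (m+(j+2)) *
          (rhoG a b (m+(j+1)) * ∏ i ∈ Finset.range j, rhoG a b (m+1+i)) := by
      rw [Finset.prod_range_succ, mul_comm, eR1, show m + 1 + (j+1) = m + (j+2) by ring]
    have hR : 0 ≤ ∏ i ∈ Finset.range j, rhoG a b (m+1+i) :=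
      Finset.prod_nonneg fun i _ => (hpos _ (by omega)).le
    rw [eR1] at ih1
    rw [e, eR2]
    constructor
    · refine aux_step_lower (ha _ hk) (hb _ hk) (hpos _ hk) (hpos _ hk') hR hα (hsq _ hk)
        (hd _) ((hh _ hk').trans ?_) ih1.1 ih0.1
      exact mul_le_mul_of_nonneg_left (hd _) (hpos _ hk).le
    · refine aux_step_upper (ha _ hk) (hb _ hk) (hpos _ hk) (hpos _ hk') hR zero_le_one (hsq _ hk)
        (Hi _) (le_trans ?_ (HH _ hk')) ih1.2 ih0.2
      exact mul_le_mul_of_nonneg_left (Hi _) (hpos _ hk).le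

lemma aux_FY (a b h H ζ : ℕ → ℝ) (A B : ℝ) (hA : 0 ≤ A) (hB : 0 ≤ B)
    (ha : ∀ k, 2 ≤ k → 0 < a k) (hb : ∀ k, 2 ≤ k → 0 < b k)
    (hζ0 : ∀ k, 2 ≤ k → 0 < ζ k)
    (hζ : ∀ k, 2 ≤ k → (ζ k)⁻¹ = a k + b k * ζ (k+1))
    (hA0 : ∀ k, A * H k ≤ 1) (hB0 : ∀ k, 1 ≤ B * h k)
    (hA1 : ∀ k, 2 ≤ k → A * H k * rhoG a b k ≤ (ζ k)⁻¹)
    (hB1 : ∀ k, 2 ≤ k → (ζ k)⁻¹ ≤ B * h k * rhoG a b k)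
    (hd : ∀ k, h (k+1) ≤ h k) (Hi : ∀ k, H k ≤ H (k+1))
    (hh : ∀ k, 2 ≤ k → h (k+1) * rhoG a b k ≤ rhoG a b (k+1) * h k)
    (HH : ∀ k, 2 ≤ k → rhoG a b (k+1) * H k ≤ H (k+1) * rhoG a b k)
    (j : ℕ) : ∀ k, 2 ≤ k →
    A * H k * ∏ i ∈ Finset.range j, rhoG a b (k+i) ≤ ∏ i ∈ Finset.range j, (ζ (k+i))⁻¹ ∧
    ∏ i ∈ Finset.range j, (ζ (k+i))⁻¹ ≤ B * h k * ∏ i ∈ Finset.range j, rhoG a b (k+i) := by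
  have hpos : ∀ k, 2 ≤ k → 0 < rhoG a b k := fun k hk => aux_rho_pos a b k (ha k hk)
  have hsq : ∀ k, 2 ≤ k → _ := fun k hk => aux_rho_sq a b k (hb k hk)
  induction j using Nat.twoStepInduction with
  | zero => intro k _; simpa using ⟨hA0 k, hB0 k⟩
  | one => intro k hk; simpa using ⟨hA1 k hk, hB1 k hk⟩
  | more j ih0 ih1 =>
    intro k hk
    have pr1 : ∀ (f : ℕ → ℝ) (k j : ℕ), ∏ i ∈ Finset.range (j+1), f (k+i)
        = f k * ∏ i ∈ Finset.range j, f (k+1+i) := by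
      intro f k j
      rw [Finset.prod_range_succ', mul_comm, add_zero]
      congr 1
      exact Finset.prod_congr rfl fun i _ => by congr 1; ring
    have i1 := ih1 (k+1) (by omega)
    have i0 := ih0 (k+2) (by omega)
    rw [pr1 (rhoG a b) (k+1) j] at i1
    rw [pr1 (rhoG a b) k (j+1), pr1 (rhoG a b) (k+1) j]
    have e : ∏ i ∈ Finset.range (j+2), (ζ (k+i))⁻¹
        = a k * ∏ i ∈ Finset.range (j+1), (ζ (k+1+i))⁻¹
          + b k * ∏ i ∈ Finset.range j, (ζ (k+2+i))⁻¹ := by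
      rw [pr1 (fun i => (ζ i)⁻¹) k (j+1), pr1 (fun i => (ζ i)⁻¹) (k+1) j, hζ k hk]
      have := (hζ0 (k+1) (by omega)).ne'
      field_simp
    have hk' : 2 ≤ k + 1 := by omega
    have hR : 0 ≤ ∏ i ∈ Finset.range j, rhoG a b (k+1+1+i) :=
      Finset.prod_nonneg fun i _ => (hpos _ (by omega)).le
    rw [e]
    constructor
    · refine aux_step_lower (ha _ hk) (hb _ hk) (hpos _ hk) (hpos _ hk') hR hA (hsq _ hk)
        (Hi _) ?_ i1.1 i0.1
      have p := mul_le_mul_of_nonneg_left (Hi (k+1)) (hpos _ hk).le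
      have := HH k hk
      linarith
    · refine aux_step_upper (ha _ hk) (hb _ hk) (hpos _ hk) (hpos _ hk') hR hB (hsq _ hk)
        (hd _) ?_ i1.2 i0.2
      have p := mul_le_mul_of_nonneg_left (hd (k+1)) (hpos _ hk).le
      have := hh k hk
      linarith

lemma aux_asc_pos (a b : ℕ → ℝ) (ha : ∀ k, 2 ≤ k → 0 < a k) (hb : ∀ k, 2 ≤ k → 0 < b k)
    (d : ℕ) : ∀ k, 2 ≤ k →
      0 < prodAscG a b k (k+d) 0 0 ∧ 0 ≤ prodAscG a b k (k+d) 1 0 := by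
  induction d with
  | zero => intro k _; simp [prodAscG]
  | succ d ih =>
    intro k hk
    have i := ih (k+1) (by omega)
    rw [show k + 1 + d = k + (d+1) by ring] at i
    rw [aux_asc_succ a b k _ (by omega), (aux_Amul _ _ _ _).1, (aux_Amul _ _ _ _).2]
    have := ha k hk; have := hb k hk
    exact ⟨add_pos_of_pos_of_nonneg (mul_pos (ha k hk) i.1) (mul_nonneg (hb k hk).le i.2), i.1.le⟩

lemma aux_zeta (a b ζ : ℕ → ℝ) (ha : ∀ k, 2 ≤ k → 0 < a k) (hb : ∀ k, 2 ≤ k → 0 < b k)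
    (hζ : ∀ k, 2 ≤ k → Tendsto (fun n => zetaApproxG a b k n) atTop (𝓝 (ζ k))) :
    ∀ k, 2 ≤ k → 0 < ζ k ∧ (ζ k)⁻¹ = a k + b k * ζ (k+1) := by
  have pos : ∀ k n, 2 ≤ k → k ≤ n → 0 < prodAscG a b k n 0 0 := by
    intro k n hk hn
    obtain ⟨d, rfl⟩ := Nat.exists_eq_add_of_le hn
    exact (aux_asc_pos a b ha hb d k hk).1
  have hnn : ∀ k, 2 ≤ k → 0 ≤ ζ k := by
    intro k hk
    refine ge_of_tendsto (hζ k hk) ?_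
    filter_upwards [eventually_ge_atTop k] with n hn
    exact div_nonneg (pos _ _ (by omega) (by omega)).le (pos _ _ hk (by omega)).le
  intro k hk
  have hlim : Tendsto (fun n => zetaApproxG a b k n * (a k + b k * zetaApproxG a b (k+1) n))
      atTop (𝓝 (ζ k * (a k + b k * ζ (k+1)))) :=
    (hζ k hk).mul (tendsto_const_nhds.add (tendsto_const_nhds.mul (hζ (k+1) (by omega))))
  have hone : ζ k * (a k + b k * ζ (k+1)) = 1 := by
    refine tendsto_nhds_unique hlim (tendsto_const_nhds.congr' ?_)
    filter_upwards [eventually_ge_atTop (k+1)] with n hn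
    have e : prodAscG a b k (n+1) 0 0
        = a k * prodAscG a b (k+1) (n+1) 0 0 + b k * prodAscG a b (k+2) (n+1) 0 0 := by
      rw [aux_asc_succ a b k _ (by omega), (aux_Amul _ _ _ _).1,
        aux_asc_succ a b (k+1) _ (by omega), (aux_Amul _ _ _ _).2]
    have p0 := pos k (n+1) hk (by omega)
    have p1 := pos (k+1) (n+1) (by omega) (by omega)
    unfold zetaApproxG
    rw [show k + 1 + 1 = k + 2 by rfl]
    have : a k + b k * (prodAscG a b (k+2) (n+1) 0 0 / prodAscG a b (k+1) (n+1) 0 0)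
        = prodAscG a b k (n+1) 0 0 / prodAscG a b (k+1) (n+1) 0 0 := by
      rw [e]; field_simp
    rw [this]
    field_simp
  have hp : 0 < ζ k := by
    refine lt_of_le_of_ne (hnn k hk) fun h0 => ?_
    rw [← h0, zero_mul] at hone
    exact zero_ne_one hone
  exact ⟨hp, inv_eq_of_mul_eq_one_right hone⟩

lemma aux_prod_conv (f : ℕ → ℝ) (m j : ℕ) :
    ∏ i ∈ Finset.Icc (m+1) (m+1+j), f i = ∏ i ∈ Finset.range (j+1), f (m+1+i) := by
  rw [show Finset.Icc (m+1) (m+1+j) = Finset.Ico (m+1) (m+1+j+1) by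
    ext x; simp only [Finset.mem_Icc, Finset.mem_Ico]; omega, Finset.prod_Ico_eq_prod_range]
  congr 2
  omega

lemma aux_fin (x : ℕ → ℝ) (m j : ℕ) (hx : ∀ i, m + 1 ≤ i → 0 ≤ x i) :
    ENNReal.ofReal (FYfinG x m (m+1+j)) = 1 + ∑ i ∈ Finset.range j,
      ENNReal.ofReal (∏ l ∈ Finset.Icc (m+1) (m+1+i), x l) := by
  have hnn : ∀ i, 0 ≤ ∏ l ∈ Finset.Icc (m+1) i, x l := fun i =>
    Finset.prod_nonneg fun l hl => hx l (Finset.mem_Icc.1 hl).1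
  unfold FYfinG
  rw [ENNReal.ofReal_add zero_le_one (Finset.sum_nonneg fun i _ => hnn i), ENNReal.ofReal_one,
    ENNReal.ofReal_sum_of_nonneg fun i _ => hnn i]
  congr 1
  rw [show Finset.Icc (m+1) (m+1+j-1) = Finset.Ico (m+1) (m+1+j) by
    ext x; simp only [Finset.mem_Icc, Finset.mem_Ico]; omega, Finset.sum_Ico_eq_sum_range]
  rw [show m + 1 + j - (m+1) = j by omega]

lemma aux_inf (x : ℕ → ℝ) (m : ℕ) (hx : ∀ i, m + 1 ≤ i → 0 ≤ x i) :
    FYinfG x m = 1 + ∑' j : ℕ, ENNReal.ofReal (∏ i ∈ Finset.Icc (m+1) (m+1+j), x i) := by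
  unfold FYinfG
  apply le_antisymm
  · refine iSup_le fun n => ?_
    by_cases hn : m + 1 ≤ n
    · obtain ⟨j, rfl⟩ := Nat.exists_eq_add_of_le hn
      rw [aux_fin x m j hx]
      gcongr
      exact ENNReal.sum_le_tsum _
    · have : FYfinG x m n = 1 := by
        unfold FYfinG
        rw [Finset.Icc_eq_empty (by omega)]
        simp
      rw [this, ENNReal.ofReal_one]
      exact le_self_add
  · rw [ENNReal.tsum_eq_iSup_nat, ENNReal.add_iSup]
    refine iSup_le fun j => ?_
    rw [← aux_fin x m j hx]
    exact le_iSup (fun n => ENNReal.ofReal (FYfinG x m n)) _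

lemma aux_tsum (c : ℝ) (x y : ℕ → ℝ) (hc : 0 ≤ c) (hc1 : c ≤ 1) (hxy : ∀ j, c * x j ≤ y j) :
    ENNReal.ofReal c * (1 + ∑' j, ENNReal.ofReal (x j)) ≤ 1 + ∑' j, ENNReal.ofReal (y j) := by
  rw [mul_add, mul_one, ← ENNReal.tsum_mul_left]
  refine add_le_add (by simpa using hc1) (ENNReal.tsum_le_tsum fun j => ?_)
  rw [← ENNReal.ofReal_mul hc]
  exact ENNReal.ofReal_le_ofReal (hxy j)

lemma aux_tsum' (c : ℝ) (x y : ℕ → ℝ) (hc1 : 1 ≤ c) (hxy : ∀ j, y j ≤ c * x j) :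
    1 + ∑' j, ENNReal.ofReal (y j) ≤ ENNReal.ofReal c * (1 + ∑' j, ENNReal.ofReal (x j)) := by
  rw [mul_add, mul_one, ← ENNReal.tsum_mul_left]
  refine add_le_add (by simpa using hc1) (ENNReal.tsum_le_tsum fun j => ?_)
  rw [← ENNReal.ofReal_mul (by linarith)]
  exact ENNReal.ofReal_le_ofReal (hxy j)

/-- Termwise monotonicity of the `D`-type sums. -/
lemma aux_D_mono (f : ℕ → ℝ) (N₀ : ℕ) (hf0 : ∀ k, 2 ≤ k → 0 ≤ f k)
    (hf : ∀ k l, N₀ ≤ k → 2 ≤ k → k ≤ l → f k ≤ f l) :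
    MonotoneOn (fun n : ℕ => (1 : ℝ≥0∞) + ∑' j : ℕ,
      ENNReal.ofReal (∏ i ∈ Finset.Icc (n + 1) (n + 1 + j), f i)) (Set.Ioi N₀) := by
  intro n hn p hp hnp
  simp only [Set.mem_Ioi] at hn hp
  refine add_le_add le_rfl (ENNReal.tsum_le_tsum fun j => ENNReal.ofReal_le_ofReal ?_)
  rw [aux_prod_conv, aux_prod_conv]
  exact Finset.prod_le_prod (fun i _ => hf0 _ (by omega))
    fun i _ => hf _ _ (by omega) (by omega) (by omega)

lemma aux_D_anti (f : ℕ → ℝ) (N₀ : ℕ) (hf0 : ∀ k, 2 ≤ k → 0 ≤ f k)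
    (hf : ∀ k l, N₀ ≤ k → 2 ≤ k → k ≤ l → f l ≤ f k) :
    AntitoneOn (fun n : ℕ => (1 : ℝ≥0∞) + ∑' j : ℕ,
      ENNReal.ofReal (∏ i ∈ Finset.Icc (n + 1) (n + 1 + j), f i)) (Set.Ioi N₀) := by
  intro n hn p hp hnp
  simp only [Set.mem_Ioi] at hn hp
  refine add_le_add le_rfl (ENNReal.tsum_le_tsum fun j => ENNReal.ofReal_le_ofReal ?_)
  rw [aux_prod_conv, aux_prod_conv]
  exact Finset.prod_le_prod (fun i _ => hf0 _ (by omega))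
    fun i _ => hf _ _ (by omega) (by omega) (by omega)

theorem D_F_comparison
    (aseq bseq : ℕ → ℝ)
    (haseq : ∀ k, 2 ≤ k → 0 < aseq k) (hbseq : ∀ k, 2 ≤ k → 0 < bseq k)
    (a b : ℝ) (ha : 0 < a) (hb : 0 < b)
    (hCa : Tendsto aseq atTop (𝓝 a))
    (hCb : Tendsto bseq atTop (𝓝 b))
    (N₀ : ℕ)
    (hmono : (∀ k l, N₀ ≤ k → k ≤ l → rhoG aseq bseq k ≤ rhoG aseq bseq l) ∨
      (∀ k l, N₀ ≤ k → k ≤ l → rhoG aseq bseq l ≤ rhoG aseq bseq k))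
    (ζ : ℕ → ℝ)
    (hζ : ∀ k, 2 ≤ k →
      Tendsto (fun n => zetaApproxG aseq bseq k n) atTop (𝓝 (ζ k))) :
    (MonotoneOn (DXG aseq bseq) (Set.Ioi N₀) ∨
      AntitoneOn (DXG aseq bseq) (Set.Ioi N₀)) ∧
    (MonotoneOn (DYG aseq bseq) (Set.Ioi N₀) ∨
      AntitoneOn (DYG aseq bseq) (Set.Ioi N₀)) ∧
    ∃ c₇ c₈ : ℝ, 0 < c₇ ∧ c₇ < c₈ ∧
      ∀ m n : ℕ, 1 ≤ m → m < n →
        (ENNReal.ofReal c₇ * DXG aseq bseq m ≤ FXG aseq bseq m ∧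
          FXG aseq bseq m ≤ ENNReal.ofReal c₈ * DXG aseq bseq m) ∧
        (ENNReal.ofReal c₇ * DYG aseq bseq m ≤ FYinfG ζ m ∧
          FYinfG ζ m ≤ ENNReal.ofReal c₈ * DYG aseq bseq m) ∧
        (c₇ * DYfinG aseq bseq m n ≤ FYfinG ζ m n ∧
          FYfinG ζ m n ≤ c₈ * DYfinG aseq bseq m n) := by
  have hpos : ∀ k, 2 ≤ k → 0 < rhoG aseq bseq k := fun k hk => aux_rho_pos _ _ k (haseq k hk)
  have hinvpos : ∀ k, 2 ≤ k → 0 ≤ (rhoG aseq bseq k)⁻¹ := fun k hk => (inv_pos.2 (hpos k hk)).le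
  refine ⟨?_, ?_, ?_⟩
  · rcases hmono with hm | hm
    · exact Or.inl (aux_D_mono _ N₀ (fun k hk => (hpos k hk).le) fun k l h1 _ h3 => hm k l h1 h3)
    · exact Or.inr (aux_D_anti _ N₀ (fun k hk => (hpos k hk).le) fun k l h1 _ h3 => hm k l h1 h3)
  · rcases hmono with hm | hm
    · exact Or.inr (aux_D_anti (fun i => (rhoG aseq bseq i)⁻¹) N₀ hinvpos fun k l h1 h2 h3 =>
        inv_anti₀ (hpos k h2) (hm k l h1 h3))
    · exact Or.inl (aux_D_mono (fun i => (rhoG aseq bseq i)⁻¹) N₀ hinvpos fun k l h1 h2 h3 =>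
        inv_anti₀ (hpos l (h2.trans h3)) (hm k l h1 h3))
  have hρlim : Tendsto (rhoG aseq bseq) atTop (𝓝 ((a + Real.sqrt (a ^ 2 + 4 * b)) / 2)) :=
    (hCa.add (((hCa.pow 2).add (hCb.const_mul 4)).sqrt)).div_const 2
  have hρL : 0 < (a + Real.sqrt (a ^ 2 + 4 * b)) / 2 := by positivity
  obtain ⟨a0, a1, ha0, ha1, hab⟩ := aux_bounds aseq a ha haseq hCa
  obtain ⟨b0, b1, hb0, hb1, hbb⟩ := aux_bounds bseq b hb hbseq hCb
  obtain ⟨r0, r1, hr0, hr1, hrb⟩ := aux_bounds _ _ hρL hpos hρlim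
  obtain ⟨h, H, hs, Hs, hs0, Hs0, hh1, HH1, hd, Hi, hh, HH⟩ :=
    aux_weights (rhoG aseq bseq) r0 r1 hr0 hrb N₀ hmono
  have hz := aux_zeta aseq bseq ζ haseq hbseq hζ
  have hzp : ∀ k, 2 ≤ k → 0 < ζ k := fun k hk => (hz k hk).1
  -- bounds for `ζ⁻¹`
  set z1 : ℝ := a1 + b1 * a0⁻¹ with hz1
  have hz1p : 0 < z1 := by positivity
  have hzlow : ∀ k, 2 ≤ k → a0 ≤ (ζ k)⁻¹ := by
    intro k hk
    rw [(hz k hk).2]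
    have := (hab k hk).1
    have := mul_pos (hbseq k hk) (hzp (k+1) (by omega))
    linarith
  have hzup : ∀ k, 2 ≤ k → (ζ k)⁻¹ ≤ z1 := by
    intro k hk
    rw [(hz k hk).2]
    have e1 := (hab k hk).2
    have e2 : ζ (k+1) ≤ a0⁻¹ := le_inv_of_le_inv₀ ha0 (hzlow (k+1) (by omega))
    have e3 := (hbb k hk).2
    have e4 := (hzp (k+1) (by omega)).le
    exact add_le_add e1 (mul_le_mul e3 e2 e4 hb1.le)
  set α : ℝ := min 1 (a0 / r1) with hα
  have hαp : 0 < α := lt_min one_pos (div_pos ha0 hr1)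
  have hα1 : α ≤ 1 := min_le_left _ _
  have hαr : ∀ k, 2 ≤ k → α * rhoG aseq bseq k ≤ a0 := by
    intro k hk
    calc α * rhoG aseq bseq k ≤ (a0 / r1) * r1 :=
          mul_le_mul (min_le_right _ _) (hrb k hk).2 (hpos k hk).le (by positivity)
      _ = a0 := by field_simp
  set A : ℝ := α / Hs with hA
  have hAp : 0 < A := div_pos hαp Hs0
  set B : ℝ := max 1 (z1 / r0) / hs with hB
  have hBp : 0 < B := div_pos (lt_max_of_lt_left one_pos) hs0
  have hAH : ∀ k, A * H k ≤ α := by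
    intro k
    calc A * H k ≤ A * Hs := by have := (HH1 k).2; gcongr
      _ = α := by rw [hA]; field_simp
  have hBh : ∀ k, max 1 (z1 / r0) ≤ B * h k := by
    intro k
    calc max 1 (z1 / r0) = B * hs := by rw [hB]; field_simp
      _ ≤ B * h k := by have := (hh1 k).1; gcongr
  have hFX := aux_FX aseq bseq h H α hαp.le hα1 haseq hbseq
    (fun k hk => (hαr k hk).trans (hab k hk).1)
    (fun k => ⟨lt_of_lt_of_le hs0 (hh1 k).1, (hh1 k).2⟩) (fun k => (HH1 k).1) hd Hi hh HH
  have hFY := aux_FY aseq bseq h H ζ A B hAp.le hBp.le haseq hbseq hzp (fun k hk => (hz k hk).2)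
    (fun k => (hAH k).trans hα1) (fun k => (le_max_left _ _).trans (hBh k))
    (fun k hk => le_trans (mul_le_mul_of_nonneg_right (hAH k) (hpos k hk).le)
      ((hαr k hk).trans (hzlow k hk)))
    (fun k hk => (hzup k hk).trans (by
      calc z1 = (z1 / r0) * r0 := by field_simp
        _ ≤ (B * h k) * rhoG aseq bseq k :=
          mul_le_mul ((le_max_right _ _).trans (hBh k)) (hrb k hk).1 hr0.le
            ((lt_of_lt_of_le (lt_max_of_lt_left one_pos) (hBh k)).le)))
    hd Hi hh HH
  set c₇ : ℝ := min 1 (min (α * hs) B⁻¹) with hc7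
  set c₈ : ℝ := max 2 (max Hs A⁻¹) with hc8
  have c7p : 0 < c₇ := lt_min one_pos (lt_min (mul_pos hαp hs0) (inv_pos.2 hBp))
  have c71 : c₇ ≤ 1 := min_le_left _ _
  have c7a : c₇ ≤ α * hs := (min_le_right _ _).trans (min_le_left _ _)
  have c7b : c₇ ≤ B⁻¹ := (min_le_right _ _).trans (min_le_right _ _)
  have c82 : 2 ≤ c₈ := le_max_left _ _
  have c8a : Hs ≤ c₈ := (le_max_left _ _).trans (le_max_right _ _)
  have c8b : A⁻¹ ≤ c₈ := (le_max_right _ _).trans (le_max_right _ _)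
  refine ⟨c₇, c₈, c7p, by linarith, ?_⟩
  intro m n hm hmn
  have hRpos : ∀ j, 0 < ∏ i ∈ Finset.range j, rhoG aseq bseq (m+1+i) := fun j =>
    Finset.prod_pos fun i _ => hpos _ (by omega)
  have hX : ∀ j, c₇ * ∏ i ∈ Finset.Icc (m+1) (m+1+j), rhoG aseq bseq i
        ≤ prodDescG aseq bseq (m+1+j) m 0 0 ∧
      prodDescG aseq bseq (m+1+j) m 0 0
        ≤ c₈ * ∏ i ∈ Finset.Icc (m+1) (m+1+j), rhoG aseq bseq i := by
    intro j
    have := hFX m hm (j+1)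
    have hR := hRpos (j+1)
    rw [aux_prod_conv, show m + 1 + j = m + (j+1) by ring]
    constructor
    · refine le_trans ?_ this.1
      have : c₇ ≤ α * h (m+(j+1)) := c7a.trans (mul_le_mul_of_nonneg_left (hh1 _).1 hαp.le)
      gcongr
    · refine this.2.trans ?_
      have : 1 * H (m+(j+1)) ≤ c₈ := by rw [one_mul]; exact (HH1 _).2.trans c8a
      gcongr
  have hY : ∀ j, c₇ * ∏ i ∈ Finset.Icc (m+1) (m+1+j), (rhoG aseq bseq i)⁻¹
        ≤ ∏ i ∈ Finset.Icc (m+1) (m+1+j), ζ i ∧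
      ∏ i ∈ Finset.Icc (m+1) (m+1+j), ζ i
        ≤ c₈ * ∏ i ∈ Finset.Icc (m+1) (m+1+j), (rhoG aseq bseq i)⁻¹ := by
    intro j
    obtain ⟨q1, q2⟩ := hFY (j+1) (m+1) (by omega)
    have hR := hRpos (j+1)
    have hZ : 0 < ∏ i ∈ Finset.range (j+1), ζ (m+1+i) :=
      Finset.prod_pos fun i _ => hzp _ (by omega)
    rw [aux_prod_conv, aux_prod_conv, Finset.prod_inv_distrib]
    rw [Finset.prod_inv_distrib] at q1 q2
    set R := ∏ i ∈ Finset.range (j+1), rhoG aseq bseq (m+1+i)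
    set Z := ∏ i ∈ Finset.range (j+1), ζ (m+1+i)
    have q1' : A * R ≤ Z⁻¹ := by
      refine le_trans ?_ q1
      have := le_mul_of_one_le_right hAp.le (HH1 (m+1)).1
      gcongr
    have q2' : Z⁻¹ ≤ B * R := by
      refine q2.trans ?_
      have := mul_le_of_le_one_right hBp.le (hh1 (m+1)).2
      gcongr
    constructor
    · calc c₇ * R⁻¹ ≤ B⁻¹ * R⁻¹ := by gcongr
        _ = (B * R)⁻¹ := by rw [mul_inv]
        _ ≤ Z := inv_le_of_inv_le₀ hZ q2'
    · calc Z ≤ (A * R)⁻¹ := le_inv_of_le_inv₀ (mul_pos hAp hR) q1'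
        _ = A⁻¹ * R⁻¹ := by rw [mul_inv]
        _ ≤ c₈ * R⁻¹ := by gcongr
  refine ⟨⟨?_, ?_⟩, ⟨?_, ?_⟩, ?_, ?_⟩
  · exact aux_tsum c₇ _ _ c7p.le c71 fun j => (hX j).1
  · exact aux_tsum' c₈ _ _ (by linarith) fun j => (hX j).2
  · rw [aux_inf ζ m fun i hi => (hzp i (by omega)).le]
    exact aux_tsum c₇ _ _ c7p.le c71 fun j => (hY j).1
  · rw [aux_inf ζ m fun i hi => (hzp i (by omega)).le]
    exact aux_tsum' c₈ _ _ (by linarith) fun j => (hY j).2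
  · unfold DYfinG FYfinG
    rw [mul_add, mul_one, Finset.mul_sum]
    refine add_le_add c71 (Finset.sum_le_sum fun j hj => ?_)
    obtain ⟨d, rfl⟩ := Nat.exists_eq_add_of_le (Finset.mem_Icc.1 hj).1
    exact (hY d).1
  · unfold DYfinG FYfinG
    rw [mul_add, mul_one, Finset.mul_sum]
    refine add_le_add (by linarith) (Finset.sum_le_sum fun j hj => ?_)
    obtain ⟨d, rfl⟩ := Nat.exists_eq_add_of_le (Finset.mem_Icc.1 hj).1
    exact (hY d).2

end
end
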